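/- arXiv:2304.00922 — 9 statements merged into one kernel-verified Lean document; each statement's English description precedes it below -/
import Mathlib

section
/- Let n, k be integers with 1 ≤ k and n ≥ 2k. A function v from the k-element subsets of Fin n to ℝ satisfies the θ₁-eigenvector equation of the Johnson graph J(n,k) with θ₁ = (k−1)(n−k−1) − 1, i.e. for every k-subset A, ∑_{B : |A ∩ B| = k−1} v(B) = ((k−1)(n−k−1) − 1) · v(A), if and only if there exists u : Fin n → ℝ with ∑_{i} u(i) = 0 such that v(A) = ∑_{i ∈ A} u(i) for every k-element subset A. -/
lemma jfe_nbr (n k : ℕ) (hk : 1 ≤ k) (v : Finset (Fin n) → ℝ) (A : Finset (Fin n))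
    (hA : A.card = k) :
    ∑ B ∈ Finset.univ.filter
          (fun B : Finset (Fin n) => B.card = k ∧ (A ∩ B).card = k - 1), v B
      = ∑ x ∈ A, ∑ y ∈ Aᶜ, v (insert y (A.erase x)) := by
  rw [← Finset.sum_product']
  symm
  apply Finset.sum_bij (fun (p : Fin n × Fin n) _ => insert p.2 (A.erase p.1))
  · rintro ⟨x, y⟩ h
    simp only [Finset.mem_product, Finset.mem_compl] at h
    obtain ⟨hx, hy⟩ := h
    simp only [Finset.mem_filter, Finset.mem_univ, true_and]
    have h1 : y ∉ A.erase x := fun h => hy (Finset.mem_of_mem_erase h)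
    constructor
    · rw [Finset.card_insert_of_notMem h1, Finset.card_erase_of_mem hx]; omega
    · have : A ∩ insert y (A.erase x) = A.erase x := by
        ext z; simp only [Finset.mem_inter, Finset.mem_insert, Finset.mem_erase]
        constructor
        · rintro ⟨g1, rfl | h2⟩
          · exact absurd g1 hy
          · exact h2
        · tauto
      rw [this, Finset.card_erase_of_mem hx]; omega
  · rintro ⟨x, y⟩ h ⟨x', y'⟩ h' e
    simp only [Finset.mem_product, Finset.mem_compl] at h h'
    have e' : ∀ z, z ∈ insert y (A.erase x) ↔ z ∈ insert y' (A.erase x') := by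
      intro z; simp only at e; rw [e]
    simp only [Finset.mem_insert, Finset.mem_erase] at e'
    have a := e' x
    have b := e' y
    obtain ⟨h1, h2⟩ := h
    obtain ⟨h3, h4⟩ := h'
    have : x = x' := by
      by_contra hne
      have : x ≠ y := fun h => h2 (h ▸ h1)
      tauto
    have : y = y' := by tauto
    simp_all
  · intro B hB
    simp only [Finset.mem_filter, Finset.mem_univ, true_and] at hB
    obtain ⟨hB, hAB⟩ := hB
    have c1 : (A \ B).card = 1 := by
      have := Finset.card_sdiff_add_card_inter A B; omega
    have c2 : (B \ A).card = 1 := by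
      have := Finset.card_sdiff_add_card_inter B A
      rw [Finset.inter_comm] at this; omega
    obtain ⟨x, hx⟩ := Finset.card_eq_one.1 c1
    obtain ⟨y, hy⟩ := Finset.card_eq_one.1 c2
    have hx' : ∀ z, (z ∈ A ∧ z ∉ B) ↔ z = x := by
      intro z; rw [← Finset.mem_sdiff, hx, Finset.mem_singleton]
    have hy' : ∀ z, (z ∈ B ∧ z ∉ A) ↔ z = y := by
      intro z; rw [← Finset.mem_sdiff, hy, Finset.mem_singleton]
    refine ⟨(x, y), ?_, ?_⟩
    · simp only [Finset.mem_product, Finset.mem_compl]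
      exact ⟨((hx' x).2 rfl).1, ((hy' y).2 rfl).2⟩
    · ext z
      simp only [Finset.mem_insert, Finset.mem_erase]
      have := hx' z
      have := hy' z
      tauto
  · intros; rfl

lemma jfe_sum_erase {n : ℕ} (u : Fin n → ℝ) (A : Finset (Fin n)) :
    ∑ x ∈ A, ∑ i ∈ A.erase x, u i = ((A.card : ℝ) - 1) * ∑ i ∈ A, u i := by
  have : ∀ x ∈ A, ∑ i ∈ A.erase x, u i = ∑ i ∈ A, u i - u x := by
    intro x hx
    rw [← Finset.add_sum_erase A u hx]; ring
  rw [Finset.sum_congr rfl this, Finset.sum_sub_distrib]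
  simp; ring

lemma jfe_star {n : ℕ} (v : Finset (Fin n) → ℝ) (A : Finset (Fin n)) :
    ∑ x ∈ A, ∑ y ∈ (A.erase x)ᶜ, v (insert y (A.erase x))
      = A.card * v A + ∑ x ∈ A, ∑ y ∈ Aᶜ, v (insert y (A.erase x)) := by
  rw [← nsmul_eq_mul, ← Finset.sum_const, ← Finset.sum_add_distrib]
  refine Finset.sum_congr rfl fun x hx => ?_
  rw [Finset.compl_erase, Finset.sum_insert (by simpa using hx), Finset.insert_erase hx]

lemma jfe_forward (n k : ℕ) (hk : 1 ≤ k) (hn : k < n) (v : Finset (Fin n) → ℝ)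
    (h : ∀ A : Finset (Fin n), A.card = k →
      ∑ x ∈ A, ∑ y ∈ Aᶜ, v (insert y (A.erase x))
        = (((k : ℝ) - 1) * ((n : ℝ) - (k : ℝ) - 1) - 1) * v A) :
    (∃ u : Fin n → ℝ, (∑ i, u i = 0) ∧
      ∀ A : Finset (Fin n), A.card = k → v A = ∑ i ∈ A, u i) := by
  induction k, hk using Nat.le_induction generalizing v with
  | base =>
    refine ⟨fun i => v {i}, ?_, ?_⟩
    · have h0 := h {⟨0, by omega⟩} (by simp)
      simp at h0
      rw [← Finset.sum_add_sum_compl {(⟨0, by omega⟩ : Fin n)}]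
      simp [h0]
    · intro A hA
      obtain ⟨a, rfl⟩ := Finset.card_eq_one.1 hA
      simp
  | succ k hk ih =>
    set d : Finset (Fin n) → ℝ := fun C => ∑ y ∈ Cᶜ, v (insert y C) with hd
    have star : ∀ A : Finset (Fin n), A.card = k + 1 →
        ∑ x ∈ A, d (A.erase x) = ((k : ℝ) * (n - k - 1)) * v A := by
      intro A hA
      rw [hd, jfe_star, h A hA, hA]; push_cast; ring
    obtain ⟨u, hu, hdu⟩ := ih (by omega) d (by
      intro C hC
      have h1 : ∀ y ∈ Cᶜ, ((k : ℝ) * (n - k - 1)) * v (insert y C)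
          = d C + ∑ x ∈ C, d (insert y (C.erase x)) := by
        intro y hy
        have hy : y ∉ C := by simpa using hy
        rw [← star _ (by rw [Finset.card_insert_of_notMem hy, hC]), Finset.sum_insert hy,
          Finset.erase_insert hy]
        congr 1
        refine Finset.sum_congr rfl fun x hx => ?_
        rw [Finset.erase_insert_of_ne]
        rintro rfl; exact hy hx
      have h2 := Finset.sum_congr rfl h1
      rw [← Finset.mul_sum, Finset.sum_add_distrib, Finset.sum_const, Finset.card_compl, hC,
        Finset.sum_comm, nsmul_eq_mul, Fintype.card_fin, Nat.cast_sub (by omega)] at h2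
      change _ * d C = _ at h2
      linear_combination -h2)
    have hk0 : (0:ℝ) < k := by exact_mod_cast hk
    have hn0 : (0:ℝ) < n - k - 1 := by
      have : ((k + 1 : ℕ) : ℝ) < n := by exact_mod_cast hn
      push_cast at this; linarith
    refine ⟨fun i => u i / (n - k - 1), ?_, ?_⟩
    · rw [← Finset.sum_div, hu, zero_div]
    · intro A hA
      have h3 := star A hA
      rw [Finset.sum_congr rfl (fun x hx => hdu (A.erase x) (by
        rw [Finset.card_erase_of_mem hx]; omega)), jfe_sum_erase, hA] at h3
      rw [← Finset.sum_div, eq_div_iff hn0.ne']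
      apply mul_left_cancel₀ hk0.ne'
      push_cast at h3
      linear_combination -h3

theorem johnson_first_eigenspace (n k : ℕ) (hk : 1 ≤ k) (hn : 2 * k ≤ n)
    (v : Finset (Fin n) → ℝ) :
    (∀ A : Finset (Fin n), A.card = k →
      ∑ B ∈ Finset.univ.filter
          (fun B : Finset (Fin n) => B.card = k ∧ (A ∩ B).card = k - 1), v B
        = (((k : ℝ) - 1) * ((n : ℝ) - (k : ℝ) - 1) - 1) * v A) ↔
    (∃ u : Fin n → ℝ, (∑ i, u i = 0) ∧
      ∀ A : Finset (Fin n), A.card = k → v A = ∑ i ∈ A, u i) := by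
  constructor
  · intro h
    apply jfe_forward n k hk (by omega)
    intro A hA
    rw [← jfe_nbr n k hk v A hA, h A hA]
  · rintro ⟨u, hu, hv⟩ A hA
    rw [jfe_nbr n k hk v A hA, hv A hA]
    have h1 : ∀ x ∈ A, ∀ y ∈ Aᶜ, v (insert y (A.erase x)) = u y + (∑ i ∈ A, u i - u x) := by
      intro x hx y hy
      have hy' : y ∉ A.erase x := fun h => (Finset.mem_compl.1 hy) (Finset.mem_of_mem_erase h)
      rw [hv _ (by rw [Finset.card_insert_of_notMem hy', Finset.card_erase_of_mem hx]; omega),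
        Finset.sum_insert hy', ← Finset.add_sum_erase A u hx]
      ring
    rw [Finset.sum_congr rfl fun x hx => Finset.sum_congr rfl (h1 x hx)]
    have h2 : ∑ y ∈ Aᶜ, u y = - ∑ i ∈ A, u i := by
      have := Finset.sum_add_sum_compl A u
      linarith
    simp only [Finset.sum_add_distrib, Finset.sum_const, h2, nsmul_eq_mul, ← Finset.mul_sum,
      Finset.sum_sub_distrib, Finset.card_compl, hA, Fintype.card_fin]
    rw [Nat.cast_sub (by omega)]
    ring
end

section
/- Let S be a Steiner triple system of order n with n ≥ 7. A function v : S → ℝ satisfies, for every block T ∈ S, ∑_{T' ∈ S, T' ≠ T, T' ∩ T ≠ ∅} v(T') = ((n−9)/2) · v(T) (the θ₁(Γ_S)-eigenvector equation of the block graph, θ₁(Γ_S) = (n−9)/2) if and only if there exists u : Fin n → ℝ with ∑_{i} u(i) = 0 such that v(T) = ∑_{i ∈ T} u(i) for every block T ∈ S. -/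
/-- A Steiner triple system of order `n`: a set `S` of 3-element subsets of `Fin n`
(blocks) such that every 2-element subset of `Fin n` is contained in exactly one block. -/
def IsSTS (n : ℕ) (S : Finset (Finset (Fin n))) : Prop :=
  (∀ T ∈ S, T.card = 3) ∧
  (∀ p : Finset (Fin n), p.card = 2 → ∃! T, T ∈ S ∧ p ⊆ T)

lemma sts_pair {n : ℕ} {S : Finset (Finset (Fin n))} (hS : IsSTS n S) {i j : Fin n} (h : i ≠ j) :
    (S.filter (fun T => j ∈ T ∧ i ∈ T)).card = 1 := by
  obtain ⟨T, hT, hu⟩ := hS.2 {i, j} (Finset.card_pair h)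
  rw [Finset.card_eq_one]
  refine ⟨T, ?_⟩
  ext T'
  simp only [Finset.mem_filter, Finset.mem_singleton]
  constructor
  · rintro ⟨h1, h2, h3⟩
    exact hu T' ⟨h1, by simp [Finset.insert_subset_iff, h2, h3]⟩
  · rintro rfl
    exact ⟨hT.1, hT.2 (by simp), hT.2 (by simp)⟩

lemma sts_star {n : ℕ} {S : Finset (Finset (Fin n))} (hS : IsSTS n S) (f : Fin n → ℝ) (j : Fin n) :
    ∑ T ∈ S.filter (fun T => j ∈ T), ∑ i ∈ T, f i
      = ((S.filter (fun T => j ∈ T)).card - 1 : ℝ) * f j + ∑ i, f i := by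
  have h1 : ∑ T ∈ S.filter (fun T => j ∈ T), ∑ i ∈ T, f i
      = ∑ i, ((S.filter (fun T => j ∈ T ∧ i ∈ T)).card : ℝ) * f i := by
    rw [Finset.sum_comm' (t' := Finset.univ)
      (s' := fun i => S.filter (fun T => j ∈ T ∧ i ∈ T))]
    · simp
    · intro x y; simp [and_assoc]
  rw [h1, ← Finset.add_sum_erase _ _ (Finset.mem_univ j),
    ← Finset.add_sum_erase Finset.univ f (Finset.mem_univ j)]
  have h2 : ∑ i ∈ Finset.univ.erase j, ((S.filter (fun T => j ∈ T ∧ i ∈ T)).card : ℝ) * f i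
      = ∑ i ∈ Finset.univ.erase j, f i := by
    refine Finset.sum_congr rfl fun i hi => ?_
    rw [sts_pair hS (Finset.ne_of_mem_erase hi)]; simp
  rw [h2]
  simp only [and_self]
  ring

lemma sts_deg {n : ℕ} {S : Finset (Finset (Fin n))} (hS : IsSTS n S) (j : Fin n) :
    ((S.filter (fun T => j ∈ T)).card : ℝ) = ((n : ℝ) - 1) / 2 := by
  have h := sts_star hS (fun _ => 1) j
  have h2 : ∑ T ∈ S.filter (fun T => j ∈ T), ∑ i ∈ T, (1 : ℝ)
      = ∑ T ∈ S.filter (fun T => j ∈ T), (3 : ℝ) := by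
    refine Finset.sum_congr rfl fun T hT => ?_
    simp [hS.1 T (Finset.mem_filter.1 hT).1]
  rw [h2] at h
  simp at h
  linarith

lemma sts_inter {n : ℕ} {S : Finset (Finset (Fin n))} (hS : IsSTS n S) {T T' : Finset (Fin n)}
    (hT : T ∈ S) (hT' : T' ∈ S) (hne : T' ≠ T) (h : (T' ∩ T).Nonempty) : (T' ∩ T).card = 1 := by
  refine le_antisymm ?_ h.card_pos
  by_contra! hc
  obtain ⟨p, hp, hp2⟩ := Finset.exists_subset_card_eq (Nat.succ_le_of_lt hc)
  obtain ⟨U, -, hu⟩ := hS.2 p hp2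
  exact hne ((hu T' ⟨hT', hp.trans Finset.inter_subset_left⟩).trans
    (hu T ⟨hT, hp.trans Finset.inter_subset_right⟩).symm)

lemma sts_adj {n : ℕ} {S : Finset (Finset (Fin n))} (hS : IsSTS n S) (v : Finset (Fin n) → ℝ)
    {T : Finset (Fin n)} (hT : T ∈ S) :
    ∑ i ∈ T, ∑ T' ∈ S.filter (fun T' => i ∈ T'), v T' = 3 * v T +
      ∑ T' ∈ S.filter (fun T' => T' ≠ T ∧ (T' ∩ T).Nonempty), v T' := by
  rw [Finset.sum_comm' (t' := S) (s' := fun T' => T' ∩ T)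
    (by intro x y; simp; tauto)]
  rw [← Finset.add_sum_erase _ _ hT, Finset.sum_filter, ← Finset.add_sum_erase _ _ hT]
  have : ∀ T' ∈ S.erase T, ∑ x ∈ T' ∩ T, v T' =
      if T' ≠ T ∧ (T' ∩ T).Nonempty then v T' else 0 := by
    intro T' h
    obtain ⟨h1, h2⟩ := Finset.mem_erase.1 h
    by_cases h3 : (T' ∩ T).Nonempty
    · rw [if_pos ⟨h1, h3⟩, Finset.sum_const, sts_inter hS hT h2 h1 h3, one_smul]
    · rw [if_neg (fun h => h3 h.2), Finset.not_nonempty_iff_eq_empty.1 h3]; simp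
  rw [Finset.sum_congr rfl this]
  simp [hS.1 T hT]

theorem blockGraph_first_eigenspace (n : ℕ) (hn : 7 ≤ n)
    (S : Finset (Finset (Fin n))) (hS : IsSTS n S) (v : Finset (Fin n) → ℝ) :
    (∀ T ∈ S, ∑ T' ∈ S.filter (fun T' => T' ≠ T ∧ (T' ∩ T).Nonempty), v T'
      = (((n : ℝ) - 9) / 2) * v T) ↔
    (∃ u : Fin n → ℝ, (∑ i, u i = 0) ∧ ∀ T ∈ S, v T = ∑ i ∈ T, u i) := by
  have hn' : (7 : ℝ) ≤ n := by exact_mod_cast hn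
  constructor
  · intro h
    set w : Fin n → ℝ := fun i => ∑ T' ∈ S.filter (fun T' => i ∈ T'), v T' with hw
    have h1 : ∀ T ∈ S, ∑ i ∈ T, w i = (((n : ℝ) - 3) / 2) * v T := by
      intro T hT
      have := sts_adj hS v hT
      rw [h T hT] at this
      rw [hw]; simp only; rw [this]; ring
    have h2 : ∑ i, w i = 3 * ∑ T ∈ S, v T := by
      rw [hw, Finset.sum_comm' (t' := S) (s' := fun T => T) (by intro x y; simp; tauto),
        Finset.mul_sum]
      refine Finset.sum_congr rfl fun T hT => ?_
      simp [hS.1 T hT]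
    have h3 : ∑ T ∈ S, ∑ i ∈ T, w i = ((n : ℝ) - 1) / 2 * ∑ i, w i := by
      rw [Finset.sum_comm' (t' := Finset.univ) (s' := fun i => S.filter (fun T => i ∈ T))
        (by intro x y; simp), Finset.mul_sum]
      refine Finset.sum_congr rfl fun i _ => ?_
      rw [Finset.sum_const, nsmul_eq_mul, sts_deg hS]
    rw [Finset.sum_congr rfl h1, ← Finset.mul_sum, h2] at h3
    have h4 : (n : ℝ) * ∑ T ∈ S, v T = 0 := by linarith
    have h5 : ∑ T ∈ S, v T = 0 := by
      rcases mul_eq_zero.1 h4 with h | h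
      · linarith
      · exact h
    have h6 : (n : ℝ) - 3 ≠ 0 := by linarith
    refine ⟨fun i => 2 / ((n : ℝ) - 3) * w i, ?_, fun T hT => ?_⟩
    · rw [← Finset.mul_sum, h2, h5]; simp
    · rw [← Finset.mul_sum, h1 T hT]; field_simp
  · rintro ⟨u, hu, hv⟩ T hT
    have h1 := sts_adj hS v hT
    have h2 : ∀ i, ∑ T' ∈ S.filter (fun T' => i ∈ T'), v T' = ((n : ℝ) - 3) / 2 * u i := by
      intro i
      rw [Finset.sum_congr rfl fun T' hT' => hv T' (Finset.mem_filter.1 hT').1,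
        sts_star hS, sts_deg hS, hu]
      ring
    simp only [h2] at h1
    rw [← Finset.mul_sum, ← hv T hT] at h1
    linarith
end

section
/- Let S be a Steiner triple system of order n with n ≥ 7. (i) If v, a real-valued function on the 3-element subsets of Fin n, satisfies the θ₁-eigenvector equation of the Johnson graph J(n,3) (for every 3-subset A, ∑_{B : |A ∩ B| = 2} v(B) = (2n−9) · v(A)), then its restriction to the blocks of S satisfies the θ₁(Γ_S)-eigenvector equation of the block graph Γ_S: for every T ∈ S, ∑_{T' ∈ S, T' ≠ T, T' ∩ T ≠ ∅} v(T') = ((n−9)/2) · v(T). (ii) Conversely, every w : S → ℝ satisfying the θ₁(Γ_S)-eigenvector equation extends to a unique function v on all 3-element subsets of Fin n satisfying the θ₁-eigenvector equation of J(n,3). -/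
/-- `v` satisfies the `θ₁ = 2n - 9` eigenvector equation of the Johnson graph `J(n,3)`. -/
def JohnsonEigen (n : ℕ) (v : Finset (Fin n) → ℝ) : Prop :=
  ∀ A : Finset (Fin n), A.card = 3 →
    ∑ B ∈ Finset.univ.filter
        (fun B : Finset (Fin n) => B.card = 3 ∧ (A ∩ B).card = 2), v B
      = (2 * (n : ℝ) - 9) * v A

/-- `v` satisfies the `θ₁ = (n-9)/2` eigenvector equation of the block graph of `S`. -/
def BlockEigen (n : ℕ) (S : Finset (Finset (Fin n))) (v : Finset (Fin n) → ℝ) : Prop :=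
  ∀ T ∈ S, ∑ T' ∈ S.filter (fun T' => T' ≠ T ∧ (T' ∩ T).Nonempty), v T'
    = (((n : ℝ) - 9) / 2) * v T


open Finset in
lemma aux_count_eq (n : ℕ) (U : Finset (Fin n)) :
    #{B : Finset (Fin n) | B.card = U.card ∧ U ⊆ B} = 1 := by
  rw [Finset.card_eq_one]
  refine ⟨U, ?_⟩
  ext B
  simp only [mem_filter, mem_univ, true_and, mem_singleton]
  constructor
  · rintro ⟨h1, h2⟩
    exact (Finset.eq_of_subset_of_card_le h2 h1.le).symm
  · rintro rfl; simp

open Finset in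
lemma aux_count_gt (n k : ℕ) (U : Finset (Fin n)) (h : k < U.card) :
    #{B : Finset (Fin n) | B.card = k ∧ U ⊆ B} = 0 := by
  rw [Finset.card_eq_zero, Finset.filter_eq_empty_iff]
  rintro B - ⟨h1, h2⟩
  have := Finset.card_le_card h2
  omega

open Finset in
lemma aux_count_succ (n : ℕ) (U : Finset (Fin n)) :
    #{B : Finset (Fin n) | B.card = U.card + 1 ∧ U ⊆ B} = n - U.card := by
  have : (univ.filter fun B : Finset (Fin n) => B.card = U.card + 1 ∧ U ⊆ B)
      = Uᶜ.image (fun z => insert z U) := by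
    ext B
    simp only [mem_filter, mem_univ, true_and, mem_image, mem_compl]
    constructor
    · rintro ⟨h1, h2⟩
      have h3 : (B \ U).card = 1 := by
        rw [Finset.card_sdiff_of_subset h2]; omega
      obtain ⟨z, hz⟩ := Finset.card_eq_one.1 h3
      have hz' : z ∈ B \ U := by rw [hz]; simp
      refine ⟨z, (mem_sdiff.1 hz').2, ?_⟩
      rw [Finset.insert_eq, ← hz, Finset.sdiff_union_of_subset h2]
    · rintro ⟨z, hz, rfl⟩
      exact ⟨Finset.card_insert_of_notMem hz, Finset.subset_insert _ _⟩
  rw [this, Finset.card_image_of_injOn, Finset.card_compl, Fintype.card_fin]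
  intro a ha b hb hab
  have ha' : a ∉ U := by simpa using ha
  have : a ∈ insert b U := by
    have : a ∈ insert a U := mem_insert_self _ _
    simpa only [hab] using this
  rcases mem_insert.1 this with h | h
  · exact h
  · exact absurd h ha'

open Finset in
/-- swap of summation: sum over sets containing `p` -/
lemma aux_swap {α β : Type*} (s : Finset α) (t : Finset β)
    (R : α → β → Prop) [∀ a b, Decidable (R a b)] (f : β → ℝ) :
    ∑ a ∈ s, ∑ b ∈ t with R a b, f b = ∑ b ∈ t, (#{a ∈ s | R a b} : ℝ) * f b := by
  simp_rw [Finset.sum_filter]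
  rw [Finset.sum_comm]
  refine Finset.sum_congr rfl fun b _ => ?_
  rw [← Finset.sum_filter, Finset.sum_const, nsmul_eq_mul]

open Finset in
noncomputable def auxG (n : ℕ) (v : Finset (Fin n) → ℝ) (p : Finset (Fin n)) : ℝ :=
  ∑ B : Finset (Fin n) with B.card = 3 ∧ p ⊆ B, v B

open Finset in
lemma auxG_sum (n : ℕ) (v : Finset (Fin n) → ℝ) (A : Finset (Fin n)) (hA : A.card = 3) :
    ∑ p ∈ A.powersetCard 2, auxG n v p = 3 * v A +
      ∑ B ∈ Finset.univ.filter
        (fun B : Finset (Fin n) => B.card = 3 ∧ (A ∩ B).card = 2), v B := by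
  have h3 : 3 * v A = ∑ B : Finset (Fin n), if B = A then 3 * v B else 0 := by simp
  unfold auxG
  rw [aux_swap, h3, Finset.sum_filter, ← Finset.sum_add_distrib]
  refine Finset.sum_congr rfl fun B _ => ?_
  by_cases hB : B.card = 3
  · have : (A.powersetCard 2).filter (fun a => B.card = 3 ∧ a ⊆ B) = (A ∩ B).powersetCard 2 := by
      ext a; simp only [mem_filter, mem_powersetCard, subset_inter_iff]; tauto
    rw [this, card_powersetCard]
    by_cases hBA : B = A
    · subst hBA; simp [hA]
    · have hlt : (A ∩ B).card < 3 := by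
        by_contra hc
        push Not at hc
        have h1 : A ∩ B = A := Finset.eq_of_subset_of_card_le inter_subset_left (by omega)
        have h2 : A ∩ B = B := Finset.eq_of_subset_of_card_le inter_subset_right (by omega)
        exact hBA (h2.symm.trans h1)
      generalize (A ∩ B).card = m at *
      interval_cases m <;> simp [hB, hBA]
  · have : B ≠ A := by rintro rfl; exact hB hA
    simp [hB, this]

open Finset in
/-- pairs inside a triple, linear functions -/
lemma aux_pairs (n : ℕ) (h : Fin n → ℝ) (A : Finset (Fin n)) (hA : A.card = 3) :
    ∑ p ∈ A.powersetCard 2, ∑ x ∈ p, h x = 2 * ∑ x ∈ A, h x := by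
  obtain ⟨a, b, c, hab, hac, hbc, rfl⟩ := Finset.card_eq_three.1 hA
  have : ({a, b, c} : Finset (Fin n)).powersetCard 2 = {{a, b}, {a, c}, {b, c}} := by
    symm
    apply Finset.eq_of_subset_of_card_le
    · intro p hp
      simp only [mem_insert, mem_singleton] at hp
      rw [mem_powersetCard]
      rcases hp with rfl | rfl | rfl
      · exact ⟨by intro x; simp; tauto, card_pair hab⟩
      · exact ⟨by intro x; simp; tauto, card_pair hac⟩
      · exact ⟨by intro x; simp; tauto, card_pair hbc⟩
    · rw [card_powersetCard, hA]
      have : ({{a, b}, {a, c}, {b, c}} : Finset (Finset (Fin n))).card = 3 := by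
        rw [Finset.card_eq_three]
        refine ⟨_, _, _, ?_, ?_, ?_, rfl⟩
        · intro h
          have : b ∈ ({a, c} : Finset (Fin n)) := by rw [← h]; simp
          simp at this; tauto
        · intro h
          have : a ∈ ({b, c} : Finset (Fin n)) := by rw [← h]; simp
          simp at this; tauto
        · intro h
          have : a ∈ ({b, c} : Finset (Fin n)) := by rw [← h]; simp
          simp at this; tauto
      rw [this]; rfl
  rw [this]
  have e1 : ({a, b} : Finset (Fin n)) ∉ ({{a, c}, {b, c}} : Finset (Finset (Fin n))) := by
    intro h
    simp only [mem_insert, mem_singleton] at h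
    rcases h with h | h
    · have : b ∈ ({a, c} : Finset (Fin n)) := by rw [← h]; simp
      simp at this; tauto
    · have : a ∈ ({b, c} : Finset (Fin n)) := by rw [← h]; simp
      simp at this; tauto
  have e2 : ({a, c} : Finset (Fin n)) ≠ {b, c} := by
    intro h
    have : a ∈ ({b, c} : Finset (Fin n)) := by rw [← h]; simp
    simp at this; tauto
  rw [sum_insert e1, sum_pair e2, sum_pair hab, sum_pair hac, sum_pair hbc,
    sum_insert (by simp [hab, hac]), sum_pair hbc]
  ring

open Finset in
/-- linear function with zero sum is an eigenvector -/
lemma aux_johnson_of_lin (n : ℕ) (hn : 7 ≤ n) (f : Fin n → ℝ) (hf : ∑ x, f x = 0) :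
    JohnsonEigen n (fun A => ∑ x ∈ A, f x) := by
  intro A hA
  have key : ∀ p : Finset (Fin n), p.card = 2 →
      auxG n (fun A => ∑ x ∈ A, f x) p = ((n : ℝ) - 3) * ∑ x ∈ p, f x := by
    intro p hp
    unfold auxG
    have e : ∀ B : Finset (Fin n), ∑ x ∈ B, f x = ∑ x with x ∈ B, f x := by
      intro B; simp
    refine (Finset.sum_congr rfl fun B _ => e B).trans ?_
    rw [aux_swap]
    have : ((n : ℝ) - 3) * ∑ x ∈ p, f x
        = ((n : ℝ) - 3) * (∑ x with x ∈ p, f x) + ∑ x, f x := by rw [hf, add_zero, e p]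
    rw [this, Finset.sum_filter, Finset.mul_sum, ← Finset.sum_add_distrib]
    refine Finset.sum_congr rfl fun y _ => ?_
    have e2 : (univ.filter fun B : Finset (Fin n) => B.card = 3 ∧ p ⊆ B).filter (fun B => y ∈ B)
        = univ.filter fun B : Finset (Fin n) => B.card = 3 ∧ insert y p ⊆ B := by
      ext B; simp only [mem_filter, mem_univ, true_and, insert_subset_iff]; tauto
    rw [e2]
    by_cases hy : y ∈ p
    · have := aux_count_succ n p
      rw [hp] at this
      rw [insert_eq_of_mem hy, this, if_pos hy, Nat.cast_sub (by omega)]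
      push_cast; ring
    · have := aux_count_eq n (insert y p)
      rw [card_insert_of_notMem hy, hp] at this
      rw [this, if_neg hy]; simp
  have h1 := auxG_sum n (fun A => ∑ x ∈ A, f x) A hA
  rw [Finset.sum_congr rfl (fun p hp => key p (mem_powersetCard.1 hp).2), ← Finset.mul_sum,
    aux_pairs n f A hA] at h1
  linarith

open Finset in
lemma aux_lin_of_johnson (n : ℕ) (hn : 7 ≤ n) (v : Finset (Fin n) → ℝ) (hv : JohnsonEigen n v) :
    ∃ f : Fin n → ℝ, ∑ x, f x = 0 ∧ ∀ A : Finset (Fin n), A.card = 3 → v A = ∑ x ∈ A, f x := by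
  have hn' : (7 : ℝ) ≤ n := by exact_mod_cast hn
  set g := auxG n v with hg
  have h1 : ∀ A : Finset (Fin n), A.card = 3 →
      ∑ p ∈ A.powersetCard 2, g p = (2 * (n : ℝ) - 6) * v A := by
    intro A hA
    rw [hg, auxG_sum n v A hA, hv A hA]; ring
  set h : Fin n → ℝ := fun x => ∑ q : Finset (Fin n) with q.card = 2 ∧ x ∈ q, g q with hh
  have h2 : ∀ p : Finset (Fin n), p.card = 2 → ((n : ℝ) - 2) * g p = ∑ x ∈ p, h x := by
    intro p hp
    have a1 : (2 * (n : ℝ) - 6) * g p = ∑ B : Finset (Fin n) with B.card = 3 ∧ p ⊆ B,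
        ∑ q : Finset (Fin n) with q.card = 2 ∧ q ⊆ B, g q := by
      rw [hg]
      conv_lhs => unfold auxG
      rw [Finset.mul_sum]
      refine Finset.sum_congr rfl fun B hB => ?_
      rw [← h1 B (mem_filter.1 hB).2.1]
      refine Finset.sum_congr ?_ fun _ _ => rfl
      ext q; simp [mem_powersetCard, and_comm]
    have a2 : ∑ x ∈ p, h x + ((n : ℝ) - 4) * g p = (2 * (n : ℝ) - 6) * g p := by
      have a3 : ((n : ℝ) - 4) * g p
          = ∑ q : Finset (Fin n), if q = p then ((n : ℝ) - 4) * g q else 0 := by simp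
      rw [a1, aux_swap (univ.filter fun B : Finset (Fin n) => B.card = 3 ∧ p ⊆ B), hh, aux_swap, a3, ← Finset.sum_add_distrib]
      refine Finset.sum_congr rfl fun q _ => ?_
      by_cases hq : q.card = 2
      · have e1 : p.filter (fun x => q.card = 2 ∧ x ∈ q) = p ∩ q := by
          ext x; simp [hq]
        have e2 : (univ.filter fun B : Finset (Fin n) => B.card = 3 ∧ p ⊆ B).filter
            (fun B => q.card = 2 ∧ q ⊆ B)
            = univ.filter fun B : Finset (Fin n) => B.card = 3 ∧ p ∪ q ⊆ B := by
          ext B; simp only [mem_filter, mem_univ, true_and, union_subset_iff]; tauto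
        rw [e1, e2]
        by_cases hqp : q = p
        · subst hqp
          have := aux_count_succ n q
          rw [hq] at this
          rw [union_self, inter_self, this, if_pos rfl, hq, Nat.cast_sub (by omega)]
          push_cast; ring
        · have hlt : (p ∩ q).card < 2 := by
            by_contra hc
            push Not at hc
            have h1 : p ∩ q = p := Finset.eq_of_subset_of_card_le inter_subset_left (by omega)
            have h2 : p ∩ q = q := Finset.eq_of_subset_of_card_le inter_subset_right (by omega)
            exact hqp (h2.symm.trans h1)
          have hu := Finset.card_union_add_card_inter p q
          rw [if_neg hqp]
          obtain h0 | h0 : (p ∩ q).card = 0 ∨ (p ∩ q).card = 1 := by omega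
          · rw [aux_count_gt n 3 (p ∪ q) (by omega), h0]; simp
          · have := aux_count_eq n (p ∪ q)
            rw [show (p ∪ q).card = 3 by omega] at this
            rw [this, h0]; simp
      · have : q ≠ p := by rintro rfl; exact hq hp
        simp [hq, this]
    linarith
  have hH : ∑ x, h x = 0 := by
    have x : Fin n := ⟨0, by omega⟩
    have a1 : ((n : ℝ) - 2) * h x = ((n : ℝ) - 2) * h x + ∑ y, h y := by
      have b1 : ((n : ℝ) - 2) * h x = ∑ q : Finset (Fin n) with q.card = 2 ∧ x ∈ q,
          ∑ y with y ∈ q, h y := by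
        conv_lhs => rw [hh]
        simp only
        rw [Finset.mul_sum]
        refine Finset.sum_congr rfl fun q hq => ?_
        rw [h2 q (mem_filter.1 hq).2.1]; simp
      have b2 : ((n : ℝ) - 2) * h x = ∑ y, if y = x then ((n : ℝ) - 2) * h y else 0 := by simp
      rw [aux_swap] at b1
      refine b1.trans ?_
      rw [b2, ← Finset.sum_add_distrib]
      refine Finset.sum_congr rfl fun y _ => ?_
      have e2 : (univ.filter fun B : Finset (Fin n) => B.card = 2 ∧ x ∈ B).filter (fun B => y ∈ B)
          = univ.filter fun B : Finset (Fin n) => B.card = 2 ∧ {y, x} ⊆ B := by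
        ext B
        simp only [mem_filter, mem_univ, true_and, insert_subset_iff, singleton_subset_iff]; tauto
      rw [e2]
      by_cases hy : y = x
      · subst hy
        have := aux_count_succ n {y}
        rw [card_singleton] at this
        rw [pair_eq_singleton, this, if_pos rfl, Nat.cast_sub (by omega)]
        push_cast; ring
      · have := aux_count_eq n {y, x}
        rw [card_pair hy] at this
        rw [this, if_neg hy]; simp
    linarith
  have n2 : (n : ℝ) - 2 ≠ 0 := by linarith
  have n3 : 2 * (n : ℝ) - 6 ≠ 0 := by linarith
  refine ⟨fun x => 2 / (((n : ℝ) - 2) * (2 * (n : ℝ) - 6)) * h x, ?_, ?_⟩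
  · rw [← Finset.mul_sum, hH, mul_zero]
  · intro A hA
    rw [← Finset.mul_sum]
    have c1 := h1 A hA
    have c2 := aux_pairs n h A hA
    rw [Finset.sum_congr rfl (fun p hp => (h2 p (mem_powersetCard.1 hp).2).symm),
      ← Finset.mul_sum, c1] at c2
    field_simp
    linarith

open Finset in
noncomputable def auxF (n : ℕ) (S : Finset (Finset (Fin n))) (w : Finset (Fin n) → ℝ)
    (x : Fin n) : ℝ := ∑ B ∈ S with x ∈ B, w B

open Finset in
lemma auxF_sum (n : ℕ) (S : Finset (Finset (Fin n))) (hS : IsSTS n S) (w : Finset (Fin n) → ℝ)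
    (T : Finset (Fin n)) (hT : T ∈ S) :
    ∑ x ∈ T, auxF n S w x = 3 * w T +
      ∑ T' ∈ S.filter (fun T' => T' ≠ T ∧ (T' ∩ T).Nonempty), w T' := by
  have h3 : 3 * w T = ∑ B ∈ S, if B = T then 3 * w B else 0 := by simp [hT]
  unfold auxF
  rw [aux_swap, h3, Finset.sum_filter, ← Finset.sum_add_distrib]
  refine Finset.sum_congr rfl fun B hB => ?_
  rw [Finset.filter_mem_eq_inter]
  by_cases hBT : B = T
  · subst hBT; simp [hS.1 B hB]
  · have hlt : (T ∩ B).card < 2 := by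
      by_contra hc
      push Not at hc
      obtain ⟨p, hp, hp2⟩ := Finset.exists_subset_card_eq hc
      exact hBT ((hS.2 p hp2).unique ⟨hB, hp.trans inter_subset_right⟩
        ⟨hT, hp.trans inter_subset_left⟩)
    simp only [inter_comm B T, ← Finset.card_pos]
    generalize (T ∩ B).card = m at *
    interval_cases m <;> simp [hBT]

open Finset in
lemma auxF_lin' (n : ℕ) (S : Finset (Finset (Fin n))) (hS : IsSTS n S) (f : Fin n → ℝ)
    (x : Fin n) : auxF n S (fun B => ∑ y ∈ B, f y) x =
      ((#{B ∈ S | x ∈ B} : ℝ) - 1) * f x + ∑ y, f y := by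
  unfold auxF
  have e : ∀ B : Finset (Fin n), ∑ x ∈ B, f x = ∑ x with x ∈ B, f x := by
    intro B; simp
  refine (Finset.sum_congr rfl fun B _ => e B).trans ?_
  have b2 : ((#{B ∈ S | x ∈ B} : ℝ) - 1) * f x
      = ∑ y, if y = x then ((#{B ∈ S | x ∈ B} : ℝ) - 1) * f y else 0 := by simp
  rw [aux_swap, b2, ← Finset.sum_add_distrib]
  refine Finset.sum_congr rfl fun y _ => ?_
  by_cases hy : y = x
  · subst hy
    rw [filter_filter]; simp only [and_self]
    rw [if_pos trivial]; ring
  · have : #{B ∈ S.filter (fun B => x ∈ B) | y ∈ B} = 1 := by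
      obtain ⟨T, ⟨hT, hT2⟩, hu⟩ := hS.2 {y, x} (card_pair hy)
      rw [Finset.card_eq_one]
      refine ⟨T, ?_⟩
      ext B
      simp only [mem_filter, mem_singleton]
      simp only [insert_subset_iff, singleton_subset_iff] at hT2 hu
      constructor
      · rintro ⟨⟨c1, c2⟩, c3⟩; exact hu B ⟨c1, c3, c2⟩
      · rintro rfl; exact ⟨⟨hT, hT2.2⟩, hT2.1⟩
    rw [this, if_neg hy]; simp

open Finset in
lemma auxF_lin (n : ℕ) (S : Finset (Finset (Fin n))) (hS : IsSTS n S) (f : Fin n → ℝ)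
    (x : Fin n) : auxF n S (fun B => ∑ y ∈ B, f y) x =
      ((n : ℝ) - 3) / 2 * f x + ∑ y, f y := by
  have h1 := auxF_lin' n S hS (fun _ => 1) x
  have h2 : auxF n S (fun B => ∑ y ∈ B, (1 : ℝ)) x = 3 * #{B ∈ S | x ∈ B} := by
    unfold auxF
    rw [Finset.sum_congr rfl (g := fun _ => (3 : ℝ)), Finset.sum_const, nsmul_eq_mul, mul_comm]
    intro B hB
    simp [hS.1 B (mem_filter.1 hB).1]
  rw [h2] at h1
  simp at h1
  rw [auxF_lin' n S hS f x]
  have : (#{B ∈ S | x ∈ B} : ℝ) = ((n : ℝ) - 1) / 2 := by linarith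
  rw [this]; ring

lemma auxF_congr (n : ℕ) (S : Finset (Finset (Fin n))) (w w' : Finset (Fin n) → ℝ)
    (h : ∀ B ∈ S, w B = w' B) (x : Fin n) : auxF n S w x = auxF n S w' x :=
  Finset.sum_congr rfl fun B hB => h B (Finset.mem_filter.1 hB).1

theorem johnson_restrict_extend (n : ℕ) (hn : 7 ≤ n)
    (S : Finset (Finset (Fin n))) (hS : IsSTS n S) :
    (∀ v : Finset (Fin n) → ℝ, JohnsonEigen n v → BlockEigen n S v) ∧
    (∀ w : Finset (Fin n) → ℝ, BlockEigen n S w →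
      ∃ v : Finset (Fin n) → ℝ,
        (JohnsonEigen n v ∧ ∀ T ∈ S, v T = w T) ∧
        ∀ v' : Finset (Fin n) → ℝ,
          (JohnsonEigen n v' ∧ ∀ T ∈ S, v' T = w T) →
          ∀ A : Finset (Fin n), A.card = 3 → v' A = v A) := by
  have hn' : (7 : ℝ) ≤ n := by exact_mod_cast hn
  have n3 : (n : ℝ) - 3 ≠ 0 := by linarith
  constructor
  · intro v hv T hT
    obtain ⟨f, hf, hvf⟩ := aux_lin_of_johnson n hn v hv
    have h1 := auxF_sum n S hS v T hT
    have h2 : ∀ x, auxF n S v x = ((n : ℝ) - 3) / 2 * f x := by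
      intro x
      rw [auxF_congr n S v (fun B => ∑ y ∈ B, f y) (fun B hB => hvf B (hS.1 B hB)) x,
        auxF_lin n S hS f x, hf, add_zero]
    simp_rw [h2] at h1
    rw [← Finset.mul_sum, ← hvf T (hS.1 T hT)] at h1
    linarith
  · intro w hw
    set f : Fin n → ℝ := fun x => 2 / ((n : ℝ) - 3) * auxF n S w x with hfdef
    have hwf : ∀ T ∈ S, ∑ x ∈ T, f x = w T := by
      intro T hT
      rw [hfdef, ← Finset.mul_sum, auxF_sum n S hS w T hT, hw T hT]
      field_simp
      ring
    have hf : ∑ x, f x = 0 := by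
      have x : Fin n := ⟨0, by omega⟩
      have h1 := auxF_lin n S hS f x
      rw [auxF_congr n S _ w hwf x] at h1
      have h2 : ((n : ℝ) - 3) / 2 * f x = auxF n S w x := by
        simp only [hfdef]; field_simp
      linarith
    refine ⟨fun A => ∑ x ∈ A, f x, ⟨aux_johnson_of_lin n hn f hf, hwf⟩, ?_⟩
    rintro v' ⟨hv', hv'w⟩ A hA
    obtain ⟨f', hf', hvf'⟩ := aux_lin_of_johnson n hn v' hv'
    rw [hvf' A hA]
    refine Finset.sum_congr rfl fun x _ => ?_
    have h1 := auxF_lin n S hS f' x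
    rw [auxF_congr n S _ w (fun B hB => by rw [← hvf' B (hS.1 B hB), hv'w B hB]) x, hf',
      add_zero] at h1
    simp only [hfdef]
    rw [h1]; field_simp
end

section
/- Let n, k be integers with 1 ≤ k and n ≥ k+1, and let u : Fin n → ℝ satisfy ∑_i u(i) = 0 and s_u(A) ∈ ℤ for every k-element subset A of Fin n. Then there exist non-negative integers r, s with 0 ≤ r < s, gcd(r,s) = 1 and s dividing gcd(n,k), such that u(i) − r/s is an integer for every i ∈ Fin n (in particular all coordinates of u have the same fractional part r/s). -/
theorem same_fractional_parts (n k : ℕ) (hk : 1 ≤ k) (hn : k + 1 ≤ n)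
    (u : Fin n → ℝ) (hsum : ∑ i, u i = 0)
    (hint : ∀ A : Finset (Fin n), A.card = k → ∃ z : ℤ, ∑ i ∈ A, u i = z) :
    ∃ r s : ℕ, r < s ∧ Nat.gcd r s = 1 ∧ s ∣ Nat.gcd n k ∧
      ∀ i : Fin n, ∃ z : ℤ, u i - (r : ℝ) / (s : ℝ) = z := by
  have hdiff : ∀ i j : Fin n, ∃ z : ℤ, u i - u j = z := by
    intro i j
    by_cases hij : i = j
    · exact ⟨0, by simp [hij]⟩
    have hc : k - 1 ≤ (Finset.univ \ {i, j} : Finset (Fin n)).card := by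
      rw [Finset.card_sdiff_of_subset (Finset.subset_univ _), Finset.card_pair hij]
      simp
      omega
    obtain ⟨B, hB, hBc⟩ := Finset.exists_subset_card_eq hc
    have hi : i ∉ B := fun h => by simpa using hB h
    have hj : j ∉ B := fun h => by simpa using hB h
    obtain ⟨a, ha⟩ := hint (insert i B) (by rw [Finset.card_insert_of_notMem hi]; omega)
    obtain ⟨b, hb⟩ := hint (insert j B) (by rw [Finset.card_insert_of_notMem hj]; omega)
    rw [Finset.sum_insert hi] at ha
    rw [Finset.sum_insert hj] at hb
    exact ⟨a - b, by push_cast; linarith⟩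
  let o : Fin n := ⟨0, by omega⟩
  choose d hd using fun i => hdiff i o
  have key : ∀ A : Finset (Fin n), (∃ z : ℤ, ∑ i ∈ A, u i = z) →
      ∃ z : ℤ, (A.card : ℝ) * u o = z := by
    rintro A ⟨z, hz⟩
    refine ⟨z - ∑ i ∈ A, d i, ?_⟩
    push_cast
    rw [← hz, ← Finset.sum_congr rfl (fun i _ => hd i), Finset.sum_sub_distrib]
    simp
  obtain ⟨a, ha⟩ := key Finset.univ ⟨0, by simpa using hsum⟩
  obtain ⟨A, -, hA⟩ := Finset.exists_subset_card_eq
    (show k ≤ (Finset.univ : Finset (Fin n)).card by simp; omega)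
  obtain ⟨b, hb⟩ := key A (hint A hA)
  rw [hA] at hb
  simp only [Finset.card_univ, Fintype.card_fin] at ha
  set g := Nat.gcd n k with hg
  have hgpos : 0 < g := Nat.gcd_pos_of_pos_right _ (by omega)
  have hgb : (g : ℝ) = n * (Nat.gcdA n k : ℤ) + k * (Nat.gcdB n k : ℤ) := by
    exact_mod_cast Nat.gcd_eq_gcd_ab n k
  obtain ⟨m, hm⟩ : ∃ m : ℤ, (g : ℝ) * u o = m :=
    ⟨a * Nat.gcdA n k + b * Nat.gcdB n k, by push_cast; rw [hgb, ← ha, ← hb]; ring⟩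
  obtain ⟨r0, hr0⟩ : ∃ r0 : ℕ, (r0 : ℤ) = m % g :=
    ⟨(m % g).toNat, Int.toNat_of_nonneg (Int.emod_nonneg _ (by omega))⟩
  have hlt : r0 < g := by
    have := Int.emod_lt_of_pos m (show (0 : ℤ) < g by omega)
    omega
  have hq : (m : ℝ) = r0 + g * (m / g : ℤ) := by
    have := Int.emod_add_mul_ediv m g
    rw [← hr0] at this
    exact_mod_cast this.symm
  have hepos : 0 < Nat.gcd r0 g := Nat.gcd_pos_of_pos_right _ hgpos
  obtain ⟨e, r, s, he, hcop, hr, hs⟩ := Nat.exists_coprime' hepos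
  have hspos : 0 < s := Nat.pos_of_ne_zero (by rintro rfl; simp at hs; omega)
  refine ⟨r, s, ?_, hcop, ⟨_, hs⟩, fun i => ⟨d i + m / g, ?_⟩⟩
  · rw [hr, hs] at hlt
    exact Nat.lt_of_mul_lt_mul_right hlt
  · have hrs : (r : ℝ) / s = r0 / g := by
      have : (e : ℝ) ≠ 0 := by positivity
      rw [hr, hs]; push_cast
      rw [mul_div_mul_right _ _ this]
    have hg0 : (g : ℝ) ≠ 0 := by positivity
    have hu : u o = r0 / g + (m / g : ℤ) := by
      field_simp
      linarith
    have := hd i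
    rw [Int.cast_add, hrs]
    linarith
end

section
/- Let n, k be integers with 1 ≤ k and n ≥ 2k. Then m(1,J(n,k)) ≤ (n−k)/gcd(n,k) + 1. -/
/-- `u` is `k`-feasible: coordinates sum to zero and the sum over every `k`-element
subset is a nonzero integer. -/
def KFeasible (n k : ℕ) (u : Fin n → ℝ) : Prop :=
  (∑ i, u i = 0) ∧
  ∀ A : Finset (Fin n), A.card = k → ∃ z : ℤ, z ≠ 0 ∧ ∑ i ∈ A, u i = z

/-- `max_A |s_u(A)|` over the `k`-element subsets `A` of `Fin n`. -/
noncomputable def maxNormJ (n k : ℕ) (u : Fin n → ℝ) : ℝ :=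
  ⨆ A : {A : Finset (Fin n) // A.card = k}, |∑ i ∈ A.1, u i|

/-- `m(1, J(n,k))`: infimum in `ℕ` of `1 + max_A |s_u(A)|` over `k`-feasible `u`. -/
noncomputable def mJ (n k : ℕ) : ℕ :=
  sInf {m : ℕ | ∃ u : Fin n → ℝ, KFeasible n k u ∧ (m : ℝ) = 1 + maxNormJ n k u}

theorem mJ_le_of_gcd (n k : ℕ) (hk : 1 ≤ k) (hn : 2 * k ≤ n) :
    mJ n k ≤ (n - k) / Nat.gcd n k + 1 := by
  obtain ⟨d, hd⟩ : ∃ d, d = Nat.gcd n k := ⟨_, rfl⟩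
  have hdpos : 0 < d := hd ▸ Nat.gcd_pos_of_pos_right n (by omega)
  obtain ⟨a, ha⟩ : d ∣ n := hd ▸ Nat.gcd_dvd_left n k
  obtain ⟨b, hb⟩ : d ∣ k := hd ▸ Nat.gcd_dvd_right n k
  rw [← hd]
  have hab : 2 * b ≤ a := by
    apply Nat.le_of_mul_le_mul_left _ hdpos
    calc d * (2 * b) = 2 * (d * b) := by ring
      _ ≤ d * a := by rw [← hb, ← ha]; exact hn
  have hb0 : 0 < b := by
    rcases Nat.eq_zero_or_pos b with h | h
    · subst h; omega
    · exact h
  have hdiv : (n - k) / d = a - b := by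
    rw [ha, hb, ← Nat.mul_sub, Nat.mul_div_cancel_left _ hdpos]
  rw [hdiv]
  have hdR : (d : ℝ) ≠ 0 := by exact_mod_cast hdpos.ne'
  have haR : (n : ℝ) = d * a := by exact_mod_cast ha
  have hbR : (k : ℝ) = d * b := by exact_mod_cast hb
  let i0 : Fin n := ⟨0, by omega⟩
  let u : Fin n → ℝ := fun i => (if i = i0 then (a : ℝ) else 0) - 1 / d
  have hsum : ∀ A : Finset (Fin n),
      ∑ i ∈ A, u i = (if i0 ∈ A then (a : ℝ) else 0) - A.card / d := by
    intro A
    simp only [u, Finset.sum_sub_distrib, Finset.sum_ite_eq', Finset.sum_const, nsmul_eq_mul]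
    ring
  have hsumk : ∀ A : Finset (Fin n), A.card = k →
      ∑ i ∈ A, u i = (if i0 ∈ A then (a : ℝ) else 0) - b := by
    intro A hA
    rw [hsum, hA, hbR, mul_div_cancel_left₀ _ hdR]
  have habR : 2 * (b : ℝ) ≤ a := by exact_mod_cast hab
  have hbR0 : (0 : ℝ) < b := by exact_mod_cast hb0
  have hle : ∀ A : {A : Finset (Fin n) // A.card = k}, |∑ i ∈ A.1, u i| ≤ (a : ℝ) - b := by
    intro A
    rw [hsumk A.1 A.2, abs_le]
    split_ifs <;> constructor <;> linarith
  obtain ⟨A0, h0, -, hA0⟩ := Finset.exists_subsuperset_card_eq (s := {i0}) (t := Finset.univ) (n := k)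
    (Finset.subset_univ _) (by simpa using hk) (by simp; omega)
  have hmem : i0 ∈ A0 := h0 (Finset.mem_singleton_self _)
  apply Nat.sInf_le
  refine ⟨u, ⟨?_, ?_⟩, ?_⟩
  · rw [hsum]
    simp only [Finset.mem_univ, if_true, Finset.card_univ, Fintype.card_fin]
    rw [haR, mul_div_cancel_left₀ _ hdR, sub_self]
  · intro A hA
    refine ⟨(if i0 ∈ A then (a : ℤ) else 0) - b, ?_, ?_⟩
    · split_ifs <;> omega
    · rw [hsumk A hA]; push_cast; rfl
  · have : maxNormJ n k u = (a : ℝ) - b := by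
      apply le_antisymm
      · haveI : Nonempty {A : Finset (Fin n) // A.card = k} := ⟨⟨A0, hA0⟩⟩
        exact ciSup_le hle
      · have h1 : |∑ i ∈ A0, u i| ≤ maxNormJ n k u :=
          le_ciSup (f := fun A : {A : Finset (Fin n) // A.card = k} => |∑ i ∈ A.1, u i|)
            ⟨_, by rintro _ ⟨A, rfl⟩; exact hle A⟩ ⟨A0, hA0⟩
        rw [hsumk A0 hA0, if_pos hmem] at h1
        exact (le_abs_self _).trans h1
    rw [this, Nat.cast_add, Nat.cast_sub (by omega)]
    push_cast; ring
end

section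
/- Let k be an odd positive integer and n ≥ k+2. (1) If n is even then m(1,J(n,k)) ≤ k+1. (2) If n is odd then m(1,J(n,k)) ≤ 2k+1. -/
theorem mJ_le_of_int (n k B : ℕ) (hkn : k ≤ n) (v : Fin n → ℤ) (h0 : ∑ i, v i = 0)
    (h : ∀ A : Finset (Fin n), A.card = k → (∑ i ∈ A, v i) ≠ 0 ∧ |∑ i ∈ A, v i| ≤ (B : ℤ)) :
    mJ n k ≤ B + 1 := by
  obtain ⟨A0, -, hA0⟩ := Finset.exists_subset_card_eq (s := (Finset.univ : Finset (Fin n)))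
    (n := k) (by simpa using hkn)
  have : Nonempty {A : Finset (Fin n) // A.card = k} := ⟨⟨A0, hA0⟩⟩
  obtain ⟨A, hA⟩ := exists_eq_ciSup_of_finite
    (f := fun A : {A : Finset (Fin n) // A.card = k} => |∑ i ∈ A.1, ((v i : ℤ) : ℝ)|)
  have h1 := abs_le.1 (h A.1 A.2).2
  have hle : mJ n k ≤ 1 + (∑ i ∈ A.1, v i).natAbs := by
    apply Nat.sInf_le
    refine ⟨fun i => (v i : ℝ), ⟨by beta_reduce; exact_mod_cast h0, fun A hA => ⟨∑ i ∈ A, v i, (h A hA).1, by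
      push_cast; rfl⟩⟩, ?_⟩
    unfold maxNormJ
    rw [← hA]
    push_cast [Nat.cast_natAbs]
    rfl
  omega

theorem sum_pm {ι : Type*} [DecidableEq ι] (v : ι → ℤ) (A : Finset ι)
    (h : ∀ i ∈ A, v i = 1 ∨ v i = -1) :
    |∑ i ∈ A, v i| ≤ (A.card : ℤ) ∧ ((∑ i ∈ A, v i) - (A.card : ℤ)) % 2 = 0 := by
  induction A using Finset.induction_on with
  | empty => simp
  | insert a s ha ih =>
    have h1 := ih (fun i hi => h i (Finset.mem_insert_of_mem hi))
    have h2 := h a (Finset.mem_insert_self _ _)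
    rw [Finset.sum_insert ha, Finset.card_insert_of_notMem ha]
    push_cast
    generalize (∑ i ∈ s, v i) = S at *
    rw [abs_le] at *
    omega

theorem sum_range_pm (a b : ℕ) :
    ∑ i ∈ Finset.range (a + b), (if i < a then (1 : ℤ) else -1) = a - b := by
  induction b with
  | zero =>
    rw [Finset.sum_congr rfl (g := fun _ => (1 : ℤ))]
    · simp
    · intro i hi
      have := Finset.mem_range.1 hi
      exact if_pos (by omega)
  | succ b ih =>
    rw [← add_assoc, Finset.sum_range_succ, ih, if_neg (by omega)]
    push_cast
    ring

theorem mJ_odd_k (n k : ℕ) (hk : 0 < k) (hkodd : Odd k) (hn : k + 2 ≤ n) :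
    (Even n → mJ n k ≤ k + 1) ∧ (Odd n → mJ n k ≤ 2 * k + 1) := by
  have hk2 := Nat.odd_iff.1 hkodd
  constructor
  · rintro ⟨m, rfl⟩
    refine mJ_le_of_int _ k k (by omega) (fun i => if i.1 < m then 1 else -1) ?_ ?_
    · rw [Fin.sum_univ_eq_sum_range (fun i => if i < m then (1 : ℤ) else -1), sum_range_pm]
      ring
    · intro A hA
      have := sum_pm (fun i : Fin (m + m) => if i.1 < m then (1 : ℤ) else -1) A
        (fun i _ => by split_ifs <;> simp)
      rw [hA] at this
      refine ⟨?_, this.1⟩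
      have h2 := this.2
      intro h0
      rw [h0] at h2
      omega
  · intro hodd
    have hn2 := Nat.odd_iff.1 hodd
    obtain ⟨p, rfl⟩ : ∃ p, n = p + (p + k + 1) + 1 := ⟨(n - k - 2) / 2, by omega⟩
    set w : Fin (p + (p + k + 1) + 1) → ℤ := fun i =>
      if i = Fin.last _ then (k : ℤ) + 1 else if i.1 < p then 1 else -1 with hw
    have hpm : ∀ i, i ≠ Fin.last _ → w i = 1 ∨ w i = -1 := by
      intro i hi
      simp only [hw, if_neg hi]
      split_ifs <;> simp
    have hl : w (Fin.last _) = k + 1 := by simp [hw]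
    refine mJ_le_of_int _ k (2 * k) (by omega) w ?_ ?_
    · rw [Fin.sum_univ_castSucc, hl]
      have : ∀ i : Fin (p + (p + k + 1)), w i.castSucc = if i.1 < p then 1 else -1 := by
        intro i
        simp only [hw, if_neg (Fin.castSucc_lt_last i).ne, Fin.val_castSucc]
      rw [Finset.sum_congr rfl (fun i _ => this i),
        Fin.sum_univ_eq_sum_range (fun i => if i < p then (1 : ℤ) else -1), sum_range_pm]
      push_cast
      ring
    · intro A hA
      by_cases hm : Fin.last _ ∈ A
      · have h1 := sum_pm w (A.erase (Fin.last _))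
          (fun i hi => hpm i (Finset.ne_of_mem_erase hi))
        rw [Finset.card_erase_of_mem hm, hA] at h1
        rw [← Finset.add_sum_erase A w hm, hl]
        generalize (∑ i ∈ A.erase (Fin.last _), w i) = S at *
        rw [abs_le] at *
        push_cast
        omega
      · have h1 := sum_pm w A (fun i hi => hpm i (fun h => hm (h ▸ hi)))
        rw [hA] at h1
        generalize (∑ i ∈ A, w i) = S at *
        rw [abs_le] at *
        push_cast
        omega
end

section
/- Let n, k be integers with 1 ≤ k ≤ n, and let u : Fin n → ℝ satisfy ∑_i u(i) = 0. Suppose a, b, r, s are non-negative integers with b ≠ 0, 0 ≤ r < s, gcd(r,s) = 1 and s dividing gcd(n,k), such that at least k coordinates of u equal a + r/s and at least k coordinates of u equal −b + r/s. If s_u(A) is a nonzero integer for every k-element subset A of Fin n, then k(bs−r)/(s(a+b)) is not an integer. -/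
theorem not_integer_of_feasible (n k : ℕ) (hk : 1 ≤ k) (hkn : k ≤ n)
    (u : Fin n → ℝ) (hsum : ∑ i, u i = 0)
    (a b r s : ℕ) (hb : b ≠ 0) (hrs : r < s) (hgcd : Nat.gcd r s = 1)
    (hdvd : s ∣ Nat.gcd n k)
    (ha : ∃ I : Finset (Fin n), k ≤ I.card ∧
      ∀ i ∈ I, u i = (a : ℝ) + (r : ℝ) / (s : ℝ))
    (hbneg : ∃ I : Finset (Fin n), k ≤ I.card ∧
      ∀ i ∈ I, u i = -(b : ℝ) + (r : ℝ) / (s : ℝ))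
    (hint : ∀ A : Finset (Fin n), A.card = k → ∃ z : ℤ, z ≠ 0 ∧ ∑ i ∈ A, u i = z) :
    ¬ ∃ z : ℤ, (k : ℝ) * ((b : ℝ) * (s : ℝ) - (r : ℝ)) / ((s : ℝ) * ((a : ℝ) + (b : ℝ)))
      = z := by
  rintro ⟨z, hz⟩
  obtain ⟨I, hIk, hI⟩ := ha
  obtain ⟨J, hJk, hJ⟩ := hbneg
  have hs : (0 : ℝ) < s := by exact_mod_cast (Nat.zero_le r).trans_lt hrs
  have hb1 : (1 : ℝ) ≤ b := by exact_mod_cast Nat.one_le_iff_ne_zero.mpr hb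
  have ha0 : (0 : ℝ) ≤ a := Nat.cast_nonneg a
  have hr0 : (0 : ℝ) ≤ r := Nat.cast_nonneg r
  have hk0 : (0 : ℝ) ≤ k := Nat.cast_nonneg k
  have hrs' : (r : ℝ) < s := by exact_mod_cast hrs
  have hab : (0 : ℝ) < (a : ℝ) + b := by linarith
  have hden : (0 : ℝ) < (s : ℝ) * ((a : ℝ) + b) := mul_pos hs hab
  have hnum : (0 : ℝ) ≤ (b : ℝ) * s - r := by nlinarith
  have hz0 : (0 : ℝ) ≤ z := by
    rw [← hz]; exact div_nonneg (mul_nonneg hk0 hnum) hden.le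
  have hzk : (z : ℝ) ≤ k := by
    rw [← hz, div_le_iff₀ hden]
    apply mul_le_mul_of_nonneg_left _ hk0
    nlinarith [mul_nonneg hs.le ha0]
  have hz0' : 0 ≤ z := by exact_mod_cast hz0
  lift z to ℕ using hz0'
  have hzk' : z ≤ k := by exact_mod_cast hzk
  obtain ⟨A, hAI, hA⟩ := Finset.exists_subset_card_eq (hzk'.trans hIk)
  obtain ⟨B, hBJ, hB⟩ := Finset.exists_subset_card_eq ((Nat.sub_le k z).trans hJk)
  have hdisj : Disjoint A B := by
    rw [Finset.disjoint_left]
    intro i hi hi'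
    have h1 := hI i (hAI hi)
    have h2 := hJ i (hBJ hi')
    linarith
  obtain ⟨w, hw, hsw⟩ := hint (A ∪ B) (by
    rw [Finset.card_union_of_disjoint hdisj, hA, hB]; omega)
  apply hw
  rw [Finset.sum_union hdisj, Finset.sum_congr rfl (fun i hi => hI i (hAI hi)),
    Finset.sum_congr rfl (fun i hi => hJ i (hBJ hi)), Finset.sum_const, Finset.sum_const,
    hA, hB, nsmul_eq_mul, nsmul_eq_mul, Nat.cast_sub hzk'] at hsw
  rw [div_eq_iff hden.ne'] at hz
  push_cast at hz
  have hq : (r : ℝ) / s * s = r := div_mul_cancel₀ _ hs.ne'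
  have h0 : (w : ℝ) * s = 0 := by
    rw [← hsw]
    linear_combination (k : ℝ) * hq - hz
  have : (w : ℝ) = 0 := (mul_eq_zero.mp h0).resolve_right hs.ne'
  exact_mod_cast this
end

section
/- Let k ≥ 2 and n > T(k). Let u : Fin n → ℝ be k-feasible and suppose u attains the minimum, i.e. max_A |s_u(A)| ≤ max_A |s_{u'}(A)| for every k-feasible u' : Fin n → ℝ (A ranging over k-element subsets of Fin n). Then there exists a positive real c such that u(i) = c for at least k indices i, and there exists a negative real d such that u(i) = d for at least k indices i. -/
/-- `γ(k)`: the smallest positive integer that does not divide `k`. -/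
noncomputable def gammaF (k : ℕ) : ℕ := sInf {m : ℕ | 0 < m ∧ ¬ m ∣ k}

/-- `j(k) = 2k` for odd `k`, and `j(k) = (⌊γ(k)/2⌋+1)(2k+γ(k))` for even `k`. -/
noncomputable def jF (k : ℕ) : ℕ :=
  if Odd k then 2 * k else (gammaF k / 2 + 1) * (2 * k + gammaF k)

/-- `T(k) = j(k)² + 2k·j(k) + 3k − j(k) − j(k)²/k`, a rational number. -/
noncomputable def TF (k : ℕ) : ℚ :=
  (jF k : ℚ) ^ 2 + 2 * (k : ℚ) * (jF k : ℚ) + 3 * (k : ℚ) - (jF k : ℚ)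
    - (jF k : ℚ) ^ 2 / (k : ℚ)


lemma gammaF_spec (k : ℕ) (hk : 2 ≤ k) : 2 ≤ gammaF k ∧ ¬ gammaF k ∣ k := by
  have hne : {m : ℕ | 0 < m ∧ ¬ m ∣ k}.Nonempty :=
    ⟨k + 1, by omega, fun h => by have := Nat.le_of_dvd (by omega) h; omega⟩
  have h := Nat.sInf_mem hne
  change 0 < gammaF k ∧ ¬ gammaF k ∣ k at h
  refine ⟨?_, h.2⟩
  by_contra hlt
  have h1 : gammaF k = 1 := by omega
  exact h.2 (h1 ▸ one_dvd k)

lemma k_gamma_le_jF (k : ℕ) (hk : 2 ≤ k) : k * gammaF k ≤ jF k := by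
  have h := gammaF_spec k hk
  unfold jF
  split_ifs with ho
  · have : gammaF k ≤ 2 := by
      apply Nat.sInf_le
      refine ⟨by omega, fun h2 => ?_⟩
      rcases ho with ⟨a, ha⟩
      omega
    nlinarith
  · have h1 : gammaF k ≤ 2 * (gammaF k / 2 + 1) := by omega
    nlinarith [Nat.zero_le (gammaF k / 2 * gammaF k)]

lemma n_big (n k : ℕ) (hk : 2 ≤ k) (hn : TF k < (n : ℚ)) :
    k * (k - 1 : ℤ) * (gammaF k) ^ 2 + k * (2 * k - 1) * gammaF k + 3 * k < n := by
  have h1 := k_gamma_le_jF k hk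
  have h1q : (k : ℚ) * gammaF k ≤ jF k := by exact_mod_cast h1
  have hkq : (2 : ℚ) ≤ k := by exact_mod_cast hk
  set g : ℚ := (gammaF k : ℚ) with hg
  set j : ℚ := (jF k : ℚ) with hj
  have hg0 : 0 ≤ g := by positivity
  have hT : TF k = j ^ 2 * (1 - 1 / k) + (2 * k - 1) * j + 3 * k := by
    unfold TF; field_simp; ring
  have hfrac : (0 : ℚ) ≤ 1 - 1 / k := by
    have : (1 : ℚ) / k ≤ 1 := by rw [div_le_one (by linarith)]; linarith
    linarith
  have e1 : (k * g) ^ 2 * (1 - 1 / k) = k * (k - 1) * g ^ 2 := by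
    field_simp
  have h2 : (k * g) ^ 2 ≤ j ^ 2 := by
    apply pow_le_pow_left₀ (by positivity) h1q
  have h3 := mul_le_mul_of_nonneg_right h2 hfrac
  have h4 : (2 * (k : ℚ) - 1) * (k * g) ≤ (2 * k - 1) * j :=
    mul_le_mul_of_nonneg_left h1q (by linarith)
  have : (k : ℚ) * (k - 1) * g ^ 2 + k * (2 * k - 1) * g + 3 * k < n := by
    nlinarith
  rw [hg] at this
  exact_mod_cast this

lemma le_maxNormJ (n k : ℕ) (u : Fin n → ℝ) (A : Finset (Fin n)) (hA : A.card = k) :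
    |∑ i ∈ A, u i| ≤ maxNormJ n k u :=
  le_ciSup (f := fun A : {A : Finset (Fin n) // A.card = k} => |∑ i ∈ A.1, u i|)
    (Set.finite_range _).bddAbove ⟨A, hA⟩

lemma maxNormJ_le (n k : ℕ) (hkn : k ≤ n) (u : Fin n → ℝ) (b : ℝ)
    (h : ∀ A : Finset (Fin n), A.card = k → |∑ i ∈ A, u i| ≤ b) :
    maxNormJ n k u ≤ b := by
  obtain ⟨A, -, hA⟩ := Finset.exists_subset_card_eq
    (s := (Finset.univ : Finset (Fin n))) (n := k) (by simpa using hkn)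
  haveI : Nonempty {A : Finset (Fin n) // A.card = k} := ⟨⟨A, hA⟩⟩
  exact ciSup_le fun A => h A.1 A.2

lemma exists_int (n k : ℕ) (g : ℕ) (hk : 2 ≤ k) (hg : 2 ≤ g) (hgk : ¬ g ∣ k)
    (hn : k + 2 ≤ n) :
    ∃ w : Fin n → ℤ, ∑ i, w i = 0 ∧ ∀ A : Finset (Fin n), A.card = k →
      ∑ i ∈ A, w i ≠ 0 ∧ |∑ i ∈ A, w i| ≤ k * g := by
  obtain ⟨n', rfl⟩ : ∃ n', n = n' + 1 := ⟨n - 1, by omega⟩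
  have hgz : (2 : ℤ) ≤ g := by exact_mod_cast hg
  have hkz : (2 : ℤ) ≤ k := by exact_mod_cast hk
  have hnz : (k : ℤ) + 1 ≤ n' := by exact_mod_cast (by omega : k + 1 ≤ n')
  obtain ⟨x, m, hx1, hx2, hxm⟩ : ∃ x : ℤ, ∃ m : ℤ, (k - 1) * ((g : ℤ) - 1) + 1 ≤ x ∧
      x ≤ (k - 1) * ((g : ℤ) - 1) + g ∧ x + n' = g * m := by
    set y : ℤ := (k - 1) * ((g : ℤ) - 1) + 1 with hy
    have a1 := Int.emod_nonneg (-(y + n')) (by omega : (g : ℤ) ≠ 0)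
    have a2 := Int.emod_lt_of_pos (-(y + n')) (by omega : (0 : ℤ) < g)
    have a3 := Int.emod_add_mul_ediv (-(y + n')) (g : ℤ)
    refine ⟨y + (-(y + n')) % g, -((-(y + n')) / g), by omega, by omega, ?_⟩
    linarith
  have hx0 : 0 < x := by nlinarith
  have hm0 : 0 ≤ m := by nlinarith
  have hmn : m ≤ n' := by
    by_contra hlt
    have : (n' : ℤ) + 1 ≤ m := by omega
    nlinarith
  lift m to ℕ using hm0
  have hmn' : m ≤ n' := by exact_mod_cast hmn
  let y : Fin (n' + 1) → ℤ := fun i => if i.val ≤ m then 1 else 0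
  have hy0 : ∀ i, 0 ≤ y i := fun i => by simp only [y]; split_ifs <;> norm_num
  have hy1 : ∀ i, y i ≤ 1 := fun i => by simp only [y]; split_ifs <;> norm_num
  let w : Fin (n' + 1) → ℤ := fun i => if i = 0 then x else 1 - g * y i
  have hs : ∀ B : Finset (Fin (n' + 1)), 0 ∉ B →
      ∃ Y : ℤ, 0 ≤ Y ∧ Y ≤ B.card ∧ ∑ i ∈ B, w i = B.card - g * Y := by
    intro B hB
    refine ⟨∑ i ∈ B, y i, Finset.sum_nonneg fun i _ => hy0 i, ?_, ?_⟩
    · calc ∑ i ∈ B, y i ≤ ∑ i ∈ B, 1 := Finset.sum_le_sum fun i _ => hy1 i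
        _ = B.card := by simp
    · rw [Finset.mul_sum]
      have : (B.card : ℤ) = ∑ i ∈ B, 1 := by simp
      rw [this, ← Finset.sum_sub_distrib]
      refine Finset.sum_congr rfl fun i hi => ?_
      have : i ≠ 0 := fun h => hB (h ▸ hi)
      simp [w, this]
  refine ⟨w, ?_, ?_⟩
  · rw [Fin.sum_univ_succ]
    have : ∀ i : Fin n', w i.succ = 1 - g * (if i.val < m then 1 else 0) := by
      intro i
      simp [w, y, Fin.succ_ne_zero, Nat.succ_le_iff]
    simp only [this]
    have hc : ∑ i : Fin n', (if i.val < m then (1 : ℤ) else 0) = m := by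
      rw [Fin.sum_univ_eq_sum_range (fun i => if i < m then (1 : ℤ) else 0) n',
        ← Finset.sum_filter]
      have : Finset.filter (fun i => i < m) (Finset.range n') = Finset.range m := by
        ext i; simp; omega
      rw [this]; simp
    rw [Finset.sum_sub_distrib, ← Finset.mul_sum, hc]
    simp [w]
    linarith
  · intro A hA
    by_cases h0 : (0 : Fin (n' + 1)) ∈ A
    · obtain ⟨Y, hY0, hY1, hY⟩ := hs (A.erase 0) (by simp)
      have hc : ((A.erase 0).card : ℤ) = k - 1 := by
        rw [Finset.card_erase_of_mem h0, hA]; push_cast [show 1 ≤ k by omega]; ring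
      rw [hc] at hY hY1
      have hw : ∑ i ∈ A, w i = x + (k - 1 - g * Y) := by
        rw [← Finset.add_sum_erase A w h0, hY]; simp [w]
      rw [hw]
      have hgY : g * Y ≤ g * (k - 1) := mul_le_mul_of_nonneg_left hY1 (by omega)
      have hgY0 : 0 ≤ g * Y := by positivity
      have hpos : 0 < x + (k - 1 - g * Y) := by nlinarith
      refine ⟨hpos.ne', ?_⟩
      rw [abs_of_pos hpos]
      nlinarith
    · obtain ⟨Y, hY0, hY1, hY⟩ := hs A h0
      rw [hA] at hY hY1
      rw [hY]
      have hgY : g * Y ≤ g * k := mul_le_mul_of_nonneg_left hY1 (by omega)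
      have hgY0 : 0 ≤ g * Y := by positivity
      refine ⟨fun h => hgk ?_, ?_⟩
      · have : (g : ℤ) ∣ k := ⟨Y, by linarith⟩
        exact_mod_cast this
      · rw [abs_le]; constructor <;> nlinarith

lemma maxNorm_bound (n k : ℕ) (hk : 2 ≤ k) (hn : k + 2 ≤ n) (u : Fin n → ℝ)
    (hmin : ∀ u' : Fin n → ℝ, KFeasible n k u' → maxNormJ n k u ≤ maxNormJ n k u') :
    maxNormJ n k u ≤ k * gammaF k := by
  obtain ⟨hg, hgk⟩ := gammaF_spec k hk
  obtain ⟨w, hw0, hw⟩ := exists_int n k _ hk hg hgk hn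
  refine (hmin (fun i => (w i : ℝ)) ⟨by beta_reduce; exact_mod_cast hw0, fun A hA =>
    ⟨∑ i ∈ A, w i, (hw A hA).1, by push_cast; rfl⟩⟩).trans ?_
  refine maxNormJ_le n k (by omega) _ _ fun A hA => ?_
  exact_mod_cast (hw A hA).2

lemma diff_int (n k : ℕ) (hk : 2 ≤ k) (hn : k + 2 ≤ n) (u : Fin n → ℝ)
    (hu : KFeasible n k u) (i l : Fin n) : ∃ z : ℤ, u i - u l = z := by
  by_cases hil : i = l
  · exact ⟨0, by simp [hil]⟩
  obtain ⟨B, hB, hc⟩ := Finset.exists_subset_card_eq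
    (s := ((Finset.univ : Finset (Fin n)).erase i).erase l) (n := k - 1) (by
      rw [Finset.card_erase_of_mem (by simp [Ne.symm hil]), Finset.card_erase_of_mem (by simp)]
      simp; omega)
  have hi : i ∉ B := fun h => by simpa using hB h
  have hl : l ∉ B := fun h => by simpa using hB h
  obtain ⟨z1, -, h1⟩ := hu.2 (insert i B) (by rw [Finset.card_insert_of_notMem hi]; omega)
  obtain ⟨z2, -, h2⟩ := hu.2 (insert l B) (by rw [Finset.card_insert_of_notMem hl]; omega)
  rw [Finset.sum_insert hi] at h1
  rw [Finset.sum_insert hl] at h2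
  exact ⟨z1 - z2, by push_cast; linarith⟩

lemma k_mul_int (n k : ℕ) (hk : 2 ≤ k) (hn : k + 2 ≤ n) (u : Fin n → ℝ)
    (hu : KFeasible n k u) (i : Fin n) : ∃ z : ℤ, k * u i = z := by
  obtain ⟨A, -, hA⟩ := Finset.exists_subset_card_eq
    (s := (Finset.univ : Finset (Fin n))) (n := k) (by simp; omega)
  obtain ⟨z, -, hz⟩ := hu.2 A hA
  choose d hd using diff_int n k hk hn u hu i
  refine ⟨z + ∑ l ∈ A, d l, ?_⟩
  push_cast
  rw [← hz, ← Finset.sum_add_distrib]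
  have : ∀ l ∈ A, u l + (d l : ℝ) = u i := fun l _ => by rw [← hd l]; ring
  rw [Finset.sum_congr rfl this]
  simp [hA]

lemma one_side (n k g : ℕ) (hk : 2 ≤ k) (hg : 2 ≤ g)
    (hn : k * (k - 1 : ℤ) * g ^ 2 + k * (2 * k - 1) * g + 3 * k < n)
    (hkn : 3 * k + 2 ≤ n)
    (u : Fin n → ℝ) (hu : KFeasible n k u)
    (hb : ∀ A : Finset (Fin n), A.card = k → |∑ i ∈ A, u i| ≤ k * g) :
    ∃ c : ℝ, 0 < c ∧ ∃ I : Finset (Fin n), k ≤ I.card ∧ ∀ i ∈ I, u i = c := by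
  classical
  by_contra hcon
  push Not at hcon
  have hn2 : k + 2 ≤ n := by omega
  have hkr : (2 : ℝ) ≤ k := by exact_mod_cast hk
  have hgr : (2 : ℝ) ≤ g := by exact_mod_cast hg
  have hnr : (k : ℝ) * (k - 1) * g ^ 2 + k * (2 * k - 1) * g + 3 * k < n := by exact_mod_cast hn
  -- few indices carry a given positive value
  have hval : ∀ c : ℝ, 0 < c → (Finset.univ.filter fun i => u i = c).card < k := by
    intro c hc
    by_contra hlt
    obtain ⟨i, hi, hne⟩ := hcon c hc _ (not_lt.mp hlt)
    exact hne (by simpa using hi)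
  set P := Finset.univ.filter fun i => 0 ≤ u i with hP
  set N := Finset.univ.filter fun i => ¬ 0 ≤ u i with hN
  have hPN : P.card + N.card = n := by
    have := Finset.card_filter_add_card_filter_not (s := (Finset.univ : Finset (Fin n)))
      (fun i => 0 ≤ u i)
    rw [Finset.card_univ, Fintype.card_fin] at this
    exact this
  have hsum : ∑ i ∈ P, u i + ∑ i ∈ N, u i = 0 := by
    rw [Finset.sum_filter_add_sum_filter_not]; exact hu.1
  -- negatives
  have hneg : (N.card : ℝ) ≤ k * ∑ i ∈ P, u i := by
    have h1 : ∑ i ∈ N, (k * u i) ≤ ∑ i ∈ N, (-1 : ℝ) := by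
      refine Finset.sum_le_sum fun i hi => ?_
      obtain ⟨z, hz⟩ := k_mul_int n k hk hn2 u hu i
      have hi' : u i < 0 := by simpa [hN] using hi
      have : (k : ℝ) * u i < 0 := mul_neg_of_pos_of_neg (by linarith) hi'
      rw [hz] at this ⊢
      have : z < 0 := by exact_mod_cast this
      exact_mod_cast (by omega : z ≤ -1)
    rw [← Finset.mul_sum] at h1
    simp at h1
    have : ∑ i ∈ P, u i = - ∑ i ∈ N, u i := by linarith
    rw [this]; linarith
  have hPNr : (P.card : ℝ) + N.card = n := by exact_mod_cast hPN
  by_cases hPk : P.card < k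
  · -- few nonnegatives
    set L := Finset.univ.filter fun i => u i < -(g : ℝ) with hL
    have hLk : L.card < k := by
      by_contra hlt
      obtain ⟨A, hAL, hA⟩ := Finset.exists_subset_card_eq (not_lt.mp hlt)
      have h1 : ∑ i ∈ A, u i < ∑ i ∈ A, -(g : ℝ) := by
        refine Finset.sum_lt_sum_of_nonempty (Finset.card_pos.mp (by omega)) fun i hi => ?_
        simpa [hL] using hAL hi
      have h2 := (abs_le.mp (hb A hA)).1
      simp [hA] at h1
      linarith
    obtain ⟨R, hRN, hR⟩ := Finset.exists_subset_card_eq (s := N \ L) (n := k - P.card) (by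
      have := Finset.le_card_sdiff L N
      omega)
    have hdis : Disjoint P R := by
      rw [Finset.disjoint_left]
      intro i hi hiR
      have := (Finset.mem_sdiff.mp (hRN hiR)).1
      simp [hN] at this
      simp [hP] at hi
      linarith
    have hc : (P ∪ R).card = k := by rw [Finset.card_union_of_disjoint hdis]; omega
    have h2 := (abs_le.mp (hb _ hc)).2
    rw [Finset.sum_union hdis] at h2
    have h3 : ∑ i ∈ R, (-(g : ℝ)) ≤ ∑ i ∈ R, u i := by
      refine Finset.sum_le_sum fun i hi => ?_
      have := (Finset.mem_sdiff.mp (hRN hi)).2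
      simpa [hL] using this
    simp at h3
    have hRk : (R.card : ℝ) ≤ k := by exact_mod_cast (by omega : R.card ≤ k)
    have hPk' : (P.card : ℝ) ≤ k := by exact_mod_cast hPk.le
    have h4 : (R.card : ℝ) * g ≤ k * g := by gcongr
    have h5 : ∑ i ∈ P, u i ≤ 2 * (k * g) := by linarith
    have h6 : k * ∑ i ∈ P, u i ≤ k * (2 * (k * g)) := by gcongr
    have h7 : (n : ℝ) ≤ k + k * (2 * (k * g)) := by linarith
    have h8 : (k : ℝ) * g ≤ k * (k - 1) * g ^ 2 := by
      have : (1 : ℝ) ≤ (k - 1) * g := by nlinarith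
      have hp : (0 : ℝ) ≤ k * g := by positivity
      nlinarith
    nlinarith
  · set S := Finset.univ.filter fun i => (g : ℝ) < u i with hS
    set Z := Finset.univ.filter fun i => u i = 0 with hZ
    set M := Finset.univ.filter fun i => 0 < u i ∧ u i ≤ g with hM
    have hSk : S.card < k := by
      by_contra hlt
      obtain ⟨A, hAL, hA⟩ := Finset.exists_subset_card_eq (not_lt.mp hlt)
      have h1 : ∑ i ∈ A, (g : ℝ) < ∑ i ∈ A, u i := by
        refine Finset.sum_lt_sum_of_nonempty (Finset.card_pos.mp (by omega)) fun i hi => ?_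
        simpa [hS] using hAL hi
      have h2 := (abs_le.mp (hb A hA)).2
      simp [hA] at h1
      linarith
    have hZk : Z.card < k := by
      by_contra hlt
      obtain ⟨A, hAL, hA⟩ := Finset.exists_subset_card_eq (not_lt.mp hlt)
      obtain ⟨z, hz0, hz⟩ := hu.2 A hA
      rw [Finset.sum_eq_zero (fun i hi => by simpa [hZ] using hAL hi)] at hz
      exact hz0 (by exact_mod_cast hz.symm)
    have hMk : M.card ≤ (k - 1) * g := by
      have := Finset.card_le_mul_card_image_of_maps_to (s := M) (t := Finset.Icc (1 : ℤ) g)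
        (f := fun i => ⌈u i⌉) (fun i hi => by
          simp only [hM, Finset.mem_filter, Finset.mem_univ, true_and] at hi
          simp only [Finset.mem_coe, Finset.mem_Icc]
          exact ⟨Int.one_le_ceil_iff.mpr hi.1, Int.ceil_le.mpr (by exact_mod_cast hi.2)⟩)
        (k - 1) (by
          intro b hb
          rcases Finset.eq_empty_or_nonempty (Finset.filter (fun i => ⌈u i⌉ = b) M) with he | ⟨i, hi⟩
          · rw [he]; simp
          · have hi' := Finset.mem_filter.mp hi
            have hi0 : 0 < u i := by have := hi'.1; simp [hM] at this; exact this.1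
            have hlt := hval (u i) hi0
            have hle : (Finset.filter (fun i => ⌈u i⌉ = b) M).card ≤
                (Finset.univ.filter fun l => u l = u i).card := by
              refine Finset.card_le_card fun l hl => ?_
              have hl' := (Finset.mem_filter.mp hl).2
              obtain ⟨z, hz⟩ := diff_int n k hk hn2 u hu l i
              have e : u l = u i + z := by linarith
              rw [e, Int.ceil_add_intCast, hi'.2] at hl'
              have : z = 0 := by omega
              simp [e, this]
            omega)
      simpa using this
    have hSP : S ⊆ P := fun i hi => by
      simp [hS] at hi; simp [hP]; linarith
    obtain ⟨A, hSA, hAP, hA⟩ := Finset.exists_subsuperset_card_eq hSP hSk.le (not_lt.mp hPk)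
    have hSs : ∑ i ∈ S, u i ≤ k * g :=
      (Finset.sum_le_sum_of_subset_of_nonneg hSA (fun i hi _ => by
        have := hAP hi; simpa [hP] using this)).trans (abs_le.mp (hb A hA)).2
    have hPsub : P ⊆ S ∪ Z ∪ M := fun i hi => by
      simp [hP] at hi
      simp only [hS, hZ, hM, Finset.mem_union, Finset.mem_filter, Finset.mem_univ, true_and]
      rcases hi.eq_or_lt with h | h
      · left; right; exact h.symm
      · rcases le_or_gt (u i) g with h' | h'
        · right; exact ⟨h, h'⟩
        · left; left; exact h'
    have hPcard : P.card ≤ S.card + Z.card + M.card :=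
      (Finset.card_le_card hPsub).trans ((Finset.card_union_le _ _).trans
        (Nat.add_le_add_right (Finset.card_union_le _ _) _))
    have hMr : (M.card : ℝ) ≤ (k - 1) * g := by
      have : (M.card : ℝ) ≤ ((k - 1 : ℕ) : ℝ) * g := by exact_mod_cast hMk
      rwa [Nat.cast_sub (by omega), Nat.cast_one] at this
    have hPsum : ∑ i ∈ P, u i ≤ ∑ i ∈ S, u i + ∑ i ∈ M, u i := by
      have e1 : ∑ i ∈ P, u i = ∑ i ∈ P \ Z, u i := by
        symm
        refine Finset.sum_subset Finset.sdiff_subset fun i hi hi' => ?_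
        have : i ∈ Z := by by_contra h; exact hi' (Finset.mem_sdiff.mpr ⟨hi, h⟩)
        simpa [hZ] using this
      have hd : Disjoint S M := by
        rw [Finset.disjoint_left]
        intro i hi hi'
        simp [hS] at hi; simp [hM] at hi'
        linarith
      rw [e1, ← Finset.sum_union hd]
      refine Finset.sum_le_sum_of_subset_of_nonneg (fun i hi => ?_) (fun i hi _ => ?_)
      · have h1 := Finset.mem_sdiff.mp hi
        have h2 := hPsub h1.1
        simp only [Finset.mem_union] at h2 ⊢
        tauto
      · rcases Finset.mem_union.mp hi with h | h
        · simp [hS] at h; linarith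
        · simp [hM] at h; linarith
    have hMs : ∑ i ∈ M, u i ≤ (k - 1) * g * g := by
      calc ∑ i ∈ M, u i ≤ ∑ i ∈ M, (g : ℝ) := Finset.sum_le_sum fun i hi => by
            simp [hM] at hi; exact hi.2
        _ = M.card * g := by simp
        _ ≤ _ := by gcongr
    have h6 : k * ∑ i ∈ P, u i ≤ k * (k * g + (k - 1) * g * g) := by
      gcongr; linarith
    have hPr : (P.card : ℝ) ≤ S.card + Z.card + M.card := by exact_mod_cast hPcard
    have hSr : (S.card : ℝ) ≤ k := by exact_mod_cast hSk.le
    have hZr : (Z.card : ℝ) ≤ k := by exact_mod_cast hZk.le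
    have h9 : ((k : ℝ) - 1) * g ≤ k * (k - 1) * g := by
      have : 0 ≤ ((k : ℝ) - 1) * g := mul_nonneg (by linarith) (by linarith)
      nlinarith
    nlinarith

theorem minimal_feasible_has_repeated_values (n k : ℕ) (hk : 2 ≤ k)
    (hn : TF k < (n : ℚ)) (u : Fin n → ℝ) (hu : KFeasible n k u)
    (hmin : ∀ u' : Fin n → ℝ, KFeasible n k u' → maxNormJ n k u ≤ maxNormJ n k u') :
    (∃ c : ℝ, 0 < c ∧ ∃ I : Finset (Fin n), k ≤ I.card ∧ ∀ i ∈ I, u i = c) ∧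
    (∃ d : ℝ, d < 0 ∧ ∃ I : Finset (Fin n), k ≤ I.card ∧ ∀ i ∈ I, u i = d) := by
  have hg := (gammaF_spec k hk).1
  have hbig := n_big n k hk hn
  have hkn : 3 * k + 2 ≤ n := by
    have hkz : (2 : ℤ) ≤ k := by exact_mod_cast hk
    have hgz : (2 : ℤ) ≤ gammaF k := by exact_mod_cast hg
    have h1 : (0 : ℤ) ≤ k * (k - 1 : ℤ) * (gammaF k) ^ 2 :=
      mul_nonneg (mul_nonneg (by omega) (by omega)) (by positivity)
    have h2 : (2 : ℤ) ≤ k * (2 * k - 1) := by nlinarith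
    have h3 : (2 : ℤ) ≤ k * (2 * k - 1) * gammaF k := by nlinarith
    have : 3 * (k : ℤ) + 2 ≤ n := by linarith
    exact_mod_cast this
  have hb : ∀ A : Finset (Fin n), A.card = k → |∑ i ∈ A, u i| ≤ k * gammaF k := fun A hA =>
    (le_maxNormJ n k u A hA).trans (maxNorm_bound n k hk (by omega) u hmin)
  refine ⟨one_side n k _ hk hg hbig hkn u hu hb, ?_⟩
  obtain ⟨c, hc, I, hI, h⟩ := one_side n k _ hk hg hbig hkn (fun i => - u i)
    ⟨by simp [hu.1], fun A hA => by
      obtain ⟨z, hz, h⟩ := hu.2 A hA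
      exact ⟨-z, by simpa using hz, by simp [h]⟩⟩
    (fun A hA => by simpa using hb A hA)
  exact ⟨-c, by linarith, I, hI, fun i hi => by have := h i hi; linarith⟩
end

section
/- Let k ≥ 2, n > T(k), and let (a,b,r,s) ∈ M(n,k). If (bs−r)·n/(s(a+b)) is an integer, then m(1,J(n,k)) = N(n,k) + 1. -/
/-- `(a,b,r,s) ∈ B(n,k)`. -/
def InB (n k a b r s : ℕ) : Prop :=
  b ≠ 0 ∧ r < s ∧ Nat.gcd r s = 1 ∧ s ∣ Nat.gcd n k ∧
    ¬ ∃ z : ℤ, (k : ℝ) * ((b : ℝ) * (s : ℝ) - (r : ℝ)) /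
      ((s : ℝ) * ((a : ℝ) + (b : ℝ))) = z

/-- `N(n,k) = min over (a,b,r,s) ∈ B(n,k) of max{k(a + r/s), k(b − r/s)}`. -/
noncomputable def Nval (n k : ℕ) : ℝ :=
  sInf {x : ℝ | ∃ a b r s : ℕ, InB n k a b r s ∧
    x = max ((k : ℝ) * ((a : ℝ) + (r : ℝ) / (s : ℝ)))
            ((k : ℝ) * ((b : ℝ) - (r : ℝ) / (s : ℝ)))}

/-- `(a,b,r,s) ∈ M(n,k)`: a quadruple of `B(n,k)` attaining the minimum `N(n,k)`. -/
noncomputable def InM (n k a b r s : ℕ) : Prop :=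
  InB n k a b r s ∧
    max ((k : ℝ) * ((a : ℝ) + (r : ℝ) / (s : ℝ)))
        ((k : ℝ) * ((b : ℝ) - (r : ℝ) / (s : ℝ))) = Nval n k

lemma aux_Nval_le (n k a b r s : ℕ) (h : InB n k a b r s) :
    Nval n k ≤ max ((k : ℝ) * ((a : ℝ) + (r : ℝ) / (s : ℝ)))
        ((k : ℝ) * ((b : ℝ) - (r : ℝ) / (s : ℝ))) := by
  apply csInf_le
  · refine ⟨0, ?_⟩
    rintro x ⟨a, b, r, s, _, rfl⟩
    apply le_max_of_le_left
    positivity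
  · exact ⟨a, b, r, s, h, rfl⟩

lemma aux_N_simple (n k a b : ℕ) (hb : b ≠ 0) (hd : ¬ (a + b) ∣ k * b) :
    Nval n k ≤ k * max (a : ℝ) b := by
  have h : InB n k a b 0 1 := by
    refine ⟨hb, by norm_num, by simp, one_dvd _, ?_⟩
    rintro ⟨z, hz⟩
    apply hd
    have hpos : (0 : ℝ) < (a : ℝ) + b := by
      have : 0 < a + b := by omega
      exact_mod_cast this
    simp only [Nat.cast_one, mul_one, Nat.cast_zero, sub_zero, one_mul] at hz
    rw [div_eq_iff hpos.ne'] at hz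
    have hz' : ((k * b : ℕ) : ℤ) = ((a + b : ℕ) : ℤ) * z := by
      have : (k : ℤ) * b = z * (a + b) := by exact_mod_cast hz
      push_cast
      rw [this]; ring
    exact Int.natCast_dvd_natCast.mp ⟨z, hz'⟩
  have h2 := aux_Nval_le n k a b 0 1 h
  have : (0 : ℝ) ≤ k := by positivity
  simp only [Nat.cast_zero, zero_div, add_zero, sub_zero] at h2
  rwa [mul_max_of_nonneg _ _ this]

lemma aux_C (n k : ℕ) (hk : 2 ≤ k) :
    ∃ C : ℕ, 1 ≤ C ∧ 2 * k * C ≤ jF k ∧ Nval n k ≤ k * C := by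
  by_cases ho : Odd k
  · refine ⟨1, le_rfl, by simp [jF, ho], ?_⟩
    have := aux_N_simple n k 1 1 one_ne_zero (by
      obtain ⟨t, rfl⟩ := ho
      omega)
    simpa using this
  · have hne : {m : ℕ | 0 < m ∧ ¬ m ∣ k}.Nonempty :=
      ⟨k + 1, by omega, fun h => by have := Nat.le_of_dvd (by omega) h; omega⟩
    have hmem := Nat.sInf_mem hne
    have hmin : ∀ m, 0 < m → m < gammaF k → m ∣ k := by
      intro m hm hlt
      by_contra hc
      exact Nat.notMem_of_lt_sInf hlt ⟨hm, hc⟩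
    change 0 < gammaF k ∧ ¬ gammaF k ∣ k at hmem
    have hj : jF k = (gammaF k / 2 + 1) * (2 * k + gammaF k) := by simp [jF, ho]
    rw [hj]
    generalize gammaF k = g at *
    obtain ⟨hg0, hgd⟩ := hmem
    have h2 : 2 ∣ k := by
      rw [Nat.not_odd_iff_even] at ho; exact ho.two_dvd
    have hg1 : g ≠ 1 := by rintro rfl; exact hgd (one_dvd _)
    have hg2 : g ≠ 2 := by rintro rfl; exact hgd h2
    refine ⟨g / 2 + 1, by omega, by nlinarith, ?_⟩
    rcases Nat.even_or_odd' g with ⟨c, rfl | rfl⟩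
    · have hce : ¬ Odd c := by
        intro hc
        apply hgd
        exact Nat.Coprime.mul_dvd_of_dvd_of_dvd (Nat.coprime_two_left.mpr hc) h2
          (hmin c (by omega) (by omega))
      have hcE : Even c := Nat.not_odd_iff_even.mp hce
      obtain ⟨d, rfl⟩ : ∃ d, c = d + 1 := ⟨c - 1, by omega⟩
      have hdodd : Odd d := by
        by_contra hh
        rw [Nat.not_odd_iff_even] at hh
        exact hce hh.add_one
      have hcop : Nat.Coprime (2 * (d + 1)) d := by
        apply Nat.Coprime.mul_left
        · exact Nat.coprime_two_left.mpr hdodd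
        · simp
      have := aux_N_simple n k (d + 2) d (by omega) (by
        intro hh
        rw [show d + 2 + d = 2 * (d + 1) by ring] at hh
        exact hgd (hcop.dvd_of_dvd_mul_right hh))
      have e : 2 * (d + 1) / 2 + 1 = d + 2 := by omega
      rw [e]
      rwa [max_eq_left (by exact_mod_cast (by omega : d ≤ d + 2))] at this
    · have hcop : Nat.Coprime (2 * c + 1) c := by simp
      have := aux_N_simple n k (c + 1) c (by omega) (by
        intro hh
        rw [show c + 1 + c = 2 * c + 1 by ring] at hh
        exact hgd (hcop.dvd_of_dvd_mul_right hh))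
      have e : (2 * c + 1) / 2 + 1 = c + 1 := by omega
      rw [e]
      rwa [max_eq_left (by exact_mod_cast (by omega : c ≤ c + 1))] at this

lemma aux_T (n k C : ℕ) (hk : 2 ≤ k) (hC : 1 ≤ C) (hj : 2 * k * C ≤ jF k)
    (hn : TF k < (n : ℚ)) : k * (C + 2) + k ^ 2 * C * (C + 1) ≤ n := by
  have hjq : (2 : ℚ) * k * C ≤ jF k := by exact_mod_cast hj
  have hkq : (2 : ℚ) ≤ k := by exact_mod_cast hk
  have hCq : (1 : ℚ) ≤ C := by exact_mod_cast hC
  unfold TF at hn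
  generalize (jF k : ℚ) = j at *
  have h1 : j ^ 2 / (k : ℚ) ≤ j ^ 2 / 2 := by
    apply div_le_div_of_nonneg_left (by positivity) (by norm_num) hkq
  have hkC : (2 : ℚ) ≤ k * C := by nlinarith
  have h2 : (2 * k * C : ℚ) ^ 2 ≤ j ^ 2 := by
    apply pow_le_pow_left₀ (by positivity) hjq
  have h3 : (2 * k - 1) * (2 * k * C : ℚ) ≤ (2 * k - 1) * j :=
    mul_le_mul_of_nonneg_left hjq (by linarith)
  have h4 : (0 : ℚ) ≤ (k * C) * (k - 2) := mul_nonneg (by linarith) (by linarith)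
  have : ((k * (C + 2) + k ^ 2 * C * (C + 1) : ℕ) : ℚ) ≤ n := by
    push_cast
    nlinarith [sq_nonneg ((k : ℚ) * C)]
  exact_mod_cast this

lemma aux_diff (n k : ℕ) (u : Fin n → ℝ) (hu : KFeasible n k u) (hk : 1 ≤ k) (hkn : k < n)
    (i j : Fin n) : ∃ z : ℤ, u i - u j = z := by
  by_cases hij : i = j
  · exact ⟨0, by simp [hij]⟩
  obtain ⟨A, hA, hAc⟩ := Finset.exists_subset_card_eq
    (s := (Finset.univ.erase i).erase j) (n := k - 1) (by
      rw [Finset.card_erase_of_mem (by simp [Ne.symm hij]), Finset.card_erase_of_mem (by simp)]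
      simp; omega)
  have hi : i ∉ A := fun h => by simpa using hA h
  have hj : j ∉ A := fun h => by simpa using hA h
  obtain ⟨z1, _, h1⟩ := hu.2 (insert i A) (by rw [Finset.card_insert_of_notMem hi]; omega)
  obtain ⟨z2, _, h2⟩ := hu.2 (insert j A) (by rw [Finset.card_insert_of_notMem hj]; omega)
  rw [Finset.sum_insert hi] at h1
  rw [Finset.sum_insert hj] at h2
  exact ⟨z1 - z2, by push_cast; linarith⟩

lemma aux_kmul (n k : ℕ) (u : Fin n → ℝ) (hu : KFeasible n k u) (hk : 1 ≤ k) (hkn : k < n)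
    (i : Fin n) : ∃ z : ℤ, k * u i = z := by
  choose f hf using aux_diff n k u hu hk hkn i
  obtain ⟨A, _, hAc⟩ := Finset.exists_subset_card_eq
    (s := (Finset.univ : Finset (Fin n))) (n := k) (by simp; omega)
  obtain ⟨z, _, hz⟩ := hu.2 A hAc
  refine ⟨z + ∑ j ∈ A, f j, ?_⟩
  push_cast
  rw [← hz, ← Finset.sum_add_distrib]
  rw [Finset.sum_congr rfl (g := fun _ => u i) (fun j _ => by rw [← hf]; ring)]
  simp [hAc]

lemma aux_nmul (n k : ℕ) (u : Fin n → ℝ) (hu : KFeasible n k u) (hk : 1 ≤ k) (hkn : k < n)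
    (i : Fin n) : ∃ z : ℤ, n * u i = z := by
  choose f hf using aux_diff n k u hu hk hkn i
  refine ⟨∑ j, f j, ?_⟩
  have h : ∑ j, (u i - u j) = ∑ j, (f j : ℝ) := Finset.sum_congr rfl (fun j _ => hf j)
  rw [Finset.sum_sub_distrib, hu.1] at h
  push_cast
  simpa using h

lemma aux_part (n k : ℕ) (u : Fin n → ℝ) (L : ℝ)
    (hL : ∀ A : Finset (Fin n), A.card = k → |∑ i ∈ A, u i| ≤ L) (m : ℕ) :
    ∀ S : Finset (Fin n), S.card = k * m → -(m * L) ≤ ∑ i ∈ S, u i := by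
  induction m with
  | zero => intro S hS; simp at hS; simp [hS]
  | succ m ih =>
    intro S hS
    rw [Nat.mul_succ] at hS
    obtain ⟨A, hA, hAc⟩ := Finset.exists_subset_card_eq (s := S) (n := k) (by omega)
    have h1 := ih (S \ A) (by rw [Finset.card_sdiff_of_subset hA]; omega)
    have h2 := (abs_le.mp (hL A hAc)).1
    rw [← Finset.sum_sdiff hA]
    push_cast
    linarith

/-- frequent negative value -/
lemma aux_freq (n k C : ℕ) (u : Fin n → ℝ) (hu : KFeasible n k u) (hk : 2 ≤ k) (hC : 1 ≤ C)
    (L : ℝ) (hL : ∀ A : Finset (Fin n), A.card = k → |∑ i ∈ A, u i| ≤ L)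
    (hLC : L < k * C) (hn : k * (C + 2) + k ^ 2 * C * (C + 1) ≤ n) :
    ∃ i, u i < 0 ∧ k ≤ (Finset.univ.filter (fun j => u j = u i)).card := by
  classical
  by_contra hcon
  push Not at hcon
  have hkn : k < n := by nlinarith [Nat.zero_le (k ^ 2 * C * (C + 1))]
  have hzero : (Finset.univ.filter (fun j => u j = 0)).card < k := by
    by_contra hc
    obtain ⟨A, hA, hAc⟩ := Finset.exists_subset_card_eq (not_lt.mp hc)
    obtain ⟨z, hz, hs⟩ := hu.2 A hAc
    rw [Finset.sum_eq_zero (fun i hi => (Finset.mem_filter.mp (hA hi)).2)] at hs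
    exact hz (by exact_mod_cast hs.symm)
  have hlow : (Finset.univ.filter (fun j => u j ≤ -C)).card < k := by
    by_contra hc
    obtain ⟨A, hA, hAc⟩ := Finset.exists_subset_card_eq (not_lt.mp hc)
    have h1 := (abs_le.mp (hL A hAc)).1
    have h2 := Finset.sum_le_card_nsmul A u (-C) (fun i hi => (Finset.mem_filter.mp (hA hi)).2)
    rw [hAc, nsmul_eq_mul] at h2
    linarith
  have hmid : (Finset.univ.filter (fun j => -C < u j ∧ u j < 0)).card ≤ (k - 1) * C := by
    have hcard := Finset.card_le_mul_card_image_of_maps_to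
      (s := Finset.univ.filter (fun j => -C < u j ∧ u j < 0))
      (t := Finset.Ico (-(C : ℤ)) 0) (f := fun j => ⌊u j⌋) (by
        intro j hj
        simp only [Finset.mem_filter, Finset.mem_univ, true_and, Finset.mem_Ico] at hj ⊢
        refine ⟨?_, ?_⟩
        · rw [Int.le_floor]; push_cast; linarith
        · rw [Int.floor_lt]; push_cast; linarith) (k - 1) (by
        intro v hv
        rcases Finset.eq_empty_or_nonempty
          ((Finset.univ.filter (fun j => -C < u j ∧ u j < 0)).filter (fun j => ⌊u j⌋ = v))
          with he | ⟨i, hi⟩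
        · rw [he]; simp
        · simp only [Finset.mem_filter, Finset.mem_univ, true_and] at hi
          have h1 := hcon i hi.1.2
          apply Nat.le_sub_one_of_lt
          refine lt_of_le_of_lt (Finset.card_le_card ?_) h1
          intro j hj
          simp only [Finset.mem_filter, Finset.mem_univ, true_and] at hj ⊢
          obtain ⟨z, hz⟩ := aux_diff n k u hu (by omega) hkn j i
          have e : u j = u i + z := by linarith
          have e2 := hj.2
          rw [e, Int.floor_add_intCast, hi.2] at e2
          have : z = 0 := by omega
          simp [e, this])
    simpa using hcard
  have hneg : (Finset.univ.filter (fun j => u j < 0)).card ≤ k * (C + 1) := by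
    have hsub : Finset.univ.filter (fun j => u j < 0) ⊆
        Finset.univ.filter (fun j => u j ≤ -C) ∪
        Finset.univ.filter (fun j => -C < u j ∧ u j < 0) := by
      intro j hj
      simp only [Finset.mem_filter, Finset.mem_univ, true_and, Finset.mem_union] at hj ⊢
      rcases le_or_gt (u j) (-C) with h | h
      · exact Or.inl h
      · exact Or.inr ⟨h, hj⟩
    have h1 := (Finset.card_le_card hsub).trans (Finset.card_union_le _ _)
    have h2 : (k - 1) * C ≤ k * C := Nat.mul_le_mul_right _ (by omega)
    rw [Nat.mul_succ]
    omega
  obtain ⟨S, hS1, _, hSc⟩ := Finset.exists_subsuperset_card_eq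
    (Finset.subset_univ (Finset.univ.filter (fun j => u j < 0))) hneg
    (by rw [Finset.card_univ, Fintype.card_fin]; nlinarith [Nat.zero_le (k ^ 2 * C * (C + 1))])
  have hpart := aux_part n k u L hL (C + 1) S hSc
  have htot : ∑ i ∈ Finset.univ \ S, u i + ∑ i ∈ S, u i = 0 := by
    rw [Finset.sum_sdiff (Finset.subset_univ S)]; exact hu.1
  have hk0 : (0 : ℝ) < k := by exact_mod_cast (by omega : 0 < k)
  have hlb : ∀ i ∈ Finset.univ \ S, (1 / k : ℝ) - (if u i = 0 then (1 / k : ℝ) else 0) ≤ u i := by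
    intro i hi
    have hnn : 0 ≤ u i := by
      by_contra hc
      simp only [Finset.mem_sdiff] at hi
      exact hi.2 (hS1 (by simpa using hc))
    split_ifs with h0
    · simp [h0]
    · obtain ⟨z, hz⟩ := aux_kmul n k u hu (by omega) hkn i
      have hp : 0 < u i := lt_of_le_of_ne hnn (Ne.symm h0)
      have hzp : (0 : ℝ) < z := by rw [← hz]; positivity
      have hz1 : (1 : ℝ) ≤ z := by
        have : 0 < z := by exact_mod_cast hzp
        exact_mod_cast this
      rw [sub_zero, div_le_iff₀ hk0]
      linarith
  have hsum := Finset.sum_le_sum hlb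
  rw [Finset.sum_sub_distrib, Finset.sum_const, ← Finset.sum_filter, Finset.sum_const,
    Finset.card_sdiff_of_subset (Finset.subset_univ S), hSc, Finset.card_univ,
    Fintype.card_fin, nsmul_eq_mul, nsmul_eq_mul] at hsum
  have hzc : ((Finset.univ \ S).filter (fun j => u j = 0)).card < k :=
    lt_of_le_of_lt (Finset.card_le_card
      (Finset.filter_subset_filter _ (Finset.subset_univ _))) hzero
  have hzc' : (((Finset.univ \ S).filter (fun j => u j = 0)).card : ℝ) ≤ k := by
    exact_mod_cast hzc.le
  have hle : k * (C + 1) ≤ n := by nlinarith [Nat.zero_le (k ^ 2 * C * (C + 1))]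
  rw [Nat.cast_sub hle] at hsum
  have hnr : ((k : ℝ) * (C + 2) + k ^ 2 * C * (C + 1)) ≤ n := by exact_mod_cast hn
  push_cast at hsum hpart
  have h5 : ((n : ℝ) - k * (C + 1) - k) * (1 / k) ≤ (C + 1) * L := by
    have := mul_le_mul_of_nonneg_right hzc' (by positivity : (0 : ℝ) ≤ 1 / k)
    linarith
  rw [mul_one_div, div_le_iff₀ hk0] at h5
  have h6 : (C + 1) * L * k < (C + 1) * (k * C) * k := by
    apply mul_lt_mul_of_pos_right _ hk0
    apply mul_lt_mul_of_pos_left hLC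
    positivity
  nlinarith

lemma aux_neg (n k : ℕ) (u : Fin n → ℝ) (hu : KFeasible n k u) :
    KFeasible n k (fun i => - u i) := by
  refine ⟨by simp [hu.1], fun A hA => ?_⟩
  obtain ⟨z, hz, h⟩ := hu.2 A hA
  exact ⟨-z, by simpa using hz, by simp [h]⟩

lemma aux_lower (n k : ℕ) (hk : 2 ≤ k) (hn : TF k < (n : ℚ))
    (u : Fin n → ℝ) (hu : KFeasible n k u) (L : ℝ)
    (hL : ∀ A : Finset (Fin n), A.card = k → |∑ i ∈ A, u i| ≤ L) : Nval n k ≤ L := by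
  classical
  obtain ⟨C, hC, hj, hN⟩ := aux_C n k hk
  have hnn := aux_T n k C hk hC hj hn
  rcases le_or_gt (k * C : ℝ) L with hle | hLC
  · exact hN.trans hle
  have hkn : k < n := by nlinarith [Nat.zero_le (k ^ 2 * C * (C + 1))]
  have hk1 : 1 ≤ k := by omega
  obtain ⟨i, hi, hic⟩ := aux_freq n k C u hu hk hC L hL hLC hnn
  obtain ⟨j, hj, hjc⟩ := aux_freq n k C _ (aux_neg n k u hu) hk hC L
    (by intro A hA; simpa using hL A hA) hLC hnn
  have hjp : 0 < u j := by linarith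
  simp only [neg_inj] at hjc
  -- rational fractional part
  obtain ⟨kz, hkz⟩ := aux_kmul n k u hu hk1 hkn i
  obtain ⟨nz, hnz⟩ := aux_nmul n k u hu hk1 hkn i
  obtain ⟨d, hd⟩ := aux_diff n k u hu hk1 hkn j i
  have hk0 : (0 : ℝ) < k := by exact_mod_cast (by omega : 0 < k)
  have hkq : (k : ℚ) ≠ 0 := by exact_mod_cast (by omega : k ≠ 0)
  obtain ⟨q, hq⟩ : ∃ q : ℚ, (q : ℝ) = Int.fract (u i) := by
    refine ⟨(kz : ℚ) / k - ⌊u i⌋, ?_⟩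
    push_cast
    rw [← hkz, Int.fract]
    field_simp
  have hq0 : 0 ≤ q := by
    have := Int.fract_nonneg (u i); rw [← hq] at this; exact_mod_cast this
  have hq1 : q < 1 := by
    have := Int.fract_lt_one (u i); rw [← hq] at this; exact_mod_cast this
  have key : ∀ (m : ℕ) (z : ℤ), m * u i = z → q.den ∣ m := by
    intro m z hz
    have h : (m : ℝ) * q = ((z - m * ⌊u i⌋ : ℤ) : ℝ) := by
      rw [hq, Int.fract]; push_cast; rw [← hz]; ring
    have h' : (m : ℚ) * q = ((z - m * ⌊u i⌋ : ℤ) : ℚ) := by exact_mod_cast h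
    have h2 : (m : ℚ) * q.num = ((z - m * ⌊u i⌋ : ℤ) : ℚ) * q.den := by
      rw [← h', mul_assoc, Rat.mul_den_eq_num]
    have h3 : (m : ℤ) * q.num = (z - m * ⌊u i⌋) * q.den := by exact_mod_cast h2
    have h4 : (q.den : ℤ) ∣ (m : ℤ) * q.num := ⟨z - m * ⌊u i⌋, by rw [h3]; ring⟩
    have hc : IsCoprime (q.den : ℤ) q.num := by
      rw [Int.isCoprime_iff_gcd_eq_one, Int.gcd_comm]
      simpa [Int.gcd] using q.reduced
    exact Int.natCast_dvd_natCast.mp (hc.dvd_of_dvd_mul_right h4)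
  have hdk := key k kz hkz
  have hdn := key n nz hnz
  have hnum0 : 0 ≤ q.num := Rat.num_nonneg.mpr hq0
  have hnumN : ((q.num.natAbs : ℕ) : ℤ) = q.num := Int.natAbs_of_nonneg hnum0
  have hrs : ((q.num.natAbs : ℕ) : ℝ) / (q.den : ℝ) = Int.fract (u i) := by
    rw [← hq]
    have : ((q.num.natAbs : ℕ) : ℝ) = (q.num : ℝ) := by
      have h9 := congrArg (Int.cast (R := ℝ)) hnumN
      rw [← h9]; rfl
    rw [this]
    exact (Rat.cast_def q).symm
  have hfj : ⌊u j⌋ = ⌊u i⌋ + d := by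
    rw [show u j = u i + d by linarith, Int.floor_add_intCast]
  have ha0 : 0 ≤ ⌊u j⌋ := Int.floor_nonneg.mpr hjp.le
  have hb0 : ⌊u i⌋ < 0 := by rw [Int.floor_lt]; simpa using hi
  obtain ⟨a, ha⟩ := Int.eq_ofNat_of_zero_le ha0
  obtain ⟨b, hb⟩ := Int.eq_ofNat_of_zero_le (by omega : 0 ≤ - ⌊u i⌋)
  have hbR : (b : ℝ) = -(⌊u i⌋ : ℝ) := by exact_mod_cast hb.symm
  have haR : (a : ℝ) = (⌊u j⌋ : ℝ) := by exact_mod_cast ha.symm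
  have hα : (a : ℝ) + Int.fract (u i) = u j := by
    rw [haR, hfj, Int.fract]; push_cast; linarith
  have hβ : (b : ℝ) - Int.fract (u i) = - u i := by
    rw [hbR, Int.fract]; ring
  have hsR : (0 : ℝ) < q.den := by exact_mod_cast q.den_pos
  have hIn : InB n k a b q.num.natAbs q.den := by
    refine ⟨by omega, ?_, q.reduced, Nat.dvd_gcd hdn hdk, ?_⟩
    · have : q.num < q.den := by
        have h9 : (q.num : ℚ) < q.den := by
          rw [← Rat.mul_den_eq_num]
          have : (0 : ℚ) < q.den := by exact_mod_cast q.den_pos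
          nlinarith
        exact_mod_cast h9
      omega
    · rintro ⟨z, hz⟩
      have e1 : (b : ℝ) * q.den - (q.num.natAbs : ℕ) = q.den * (- u i) := by
        rw [← hβ, ← hrs]; field_simp
      have e2 : (a : ℝ) + b = u j - u i := by linarith
      have hpos : 0 < u j - u i := by linarith
      rw [e1, e2, div_eq_iff (by positivity)] at hz
      have hz2 : (k : ℝ) * (- u i) = z * (u j - u i) := by
        apply mul_left_cancel₀ hsR.ne'; linarith
      have hz0 : (0 : ℝ) ≤ z := by
        by_contra hc; push Not at hc; nlinarith
      have hzk : (z : ℝ) ≤ k := by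
        by_contra hc; push Not at hc; nlinarith
      have hz0' : 0 ≤ z := by exact_mod_cast hz0
      obtain ⟨t, rfl⟩ := Int.eq_ofNat_of_zero_le hz0'
      have htk : t ≤ k := by exact_mod_cast hzk
      obtain ⟨A, hA, hAc⟩ := Finset.exists_subset_card_eq (htk.trans hjc)
      obtain ⟨B, hB, hBc⟩ := Finset.exists_subset_card_eq ((Nat.sub_le k t).trans hic)
      have hdisj : Disjoint A B := by
        rw [Finset.disjoint_left]
        intro x hxA hxB
        have h1 := (Finset.mem_filter.mp (hA hxA)).2
        have h2 := (Finset.mem_filter.mp (hB hxB)).2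
        linarith
      obtain ⟨w, hw, hws⟩ := hu.2 (A ∪ B) (by
        rw [Finset.card_union_of_disjoint hdisj]; omega)
      rw [Finset.sum_union hdisj,
        Finset.sum_congr rfl (fun x hx => (Finset.mem_filter.mp (hA hx)).2),
        Finset.sum_congr (s₁ := B) rfl (fun x hx => (Finset.mem_filter.mp (hB hx)).2),
        Finset.sum_const, Finset.sum_const, hAc, hBc, nsmul_eq_mul, nsmul_eq_mul,
        Nat.cast_sub htk] at hws
      push_cast at hz2
      have : (w : ℝ) = 0 := by rw [← hws]; linarith
      exact hw (by exact_mod_cast this)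
  refine (aux_Nval_le _ _ _ _ _ _ hIn).trans ?_
  rw [hrs, hα, hβ]
  apply max_le
  · obtain ⟨A, hA, hAc⟩ := Finset.exists_subset_card_eq hjc
    have h := (abs_le.mp (hL A hAc)).2
    rw [Finset.sum_congr rfl (fun x hx => (Finset.mem_filter.mp (hA hx)).2),
      Finset.sum_const, hAc, nsmul_eq_mul] at h
    exact h
  · obtain ⟨A, hA, hAc⟩ := Finset.exists_subset_card_eq hic
    have h := (abs_le.mp (hL A hAc)).1
    rw [Finset.sum_congr rfl (fun x hx => (Finset.mem_filter.mp (hA hx)).2),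
      Finset.sum_const, hAc, nsmul_eq_mul] at h
    linarith

lemma aux_upper (n k a b r s : ℕ) (h : InB n k a b r s)
    (hint : ∃ z : ℤ, ((b : ℝ) * (s : ℝ) - (r : ℝ)) * (n : ℝ) /
      ((s : ℝ) * ((a : ℝ) + (b : ℝ))) = z) :
    ∃ u : Fin n → ℝ, KFeasible n k u ∧ ∀ A : Finset (Fin n), A.card = k →
      |∑ i ∈ A, u i| ≤ max ((k : ℝ) * ((a : ℝ) + (r : ℝ) / (s : ℝ)))
        ((k : ℝ) * ((b : ℝ) - (r : ℝ) / (s : ℝ))) := by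
  classical
  obtain ⟨hb, hrs, hg, hsd, hni⟩ := h
  obtain ⟨z, hz⟩ := hint
  have hs0 : (0 : ℝ) < s := by exact_mod_cast (by omega : 0 < s)
  have hb1 : (1 : ℝ) ≤ b := by exact_mod_cast (by omega : 1 ≤ b)
  have ha0 : (0 : ℝ) ≤ a := by positivity
  have hf1 : (r : ℝ) / s < 1 := by
    rw [div_lt_one hs0]; exact_mod_cast hrs
  have hf0 : (0 : ℝ) ≤ (r : ℝ) / s := by positivity
  have hr : (r : ℝ) = s * ((r : ℝ) / s) := by field_simp
  have hkf : ∃ c : ℤ, (k : ℝ) * ((r : ℝ) / s) = c := by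
    obtain ⟨c, hc⟩ := hsd.trans (Nat.gcd_dvd_right n k)
    refine ⟨c * r, ?_⟩
    rw [hc]; push_cast; field_simp
  have hab : (0 : ℝ) < a + b := by linarith
  have hz2 : ((b : ℝ) - (r : ℝ) / s) * n = z * (a + b) := by
    rw [div_eq_iff (by positivity)] at hz
    apply mul_left_cancel₀ hs0.ne'
    have : (s : ℝ) * ((b - (r : ℝ) / s) * n) = (b * s - s * ((r : ℝ) / s)) * n := by ring
    rw [this, ← hr, hz]; ring
  have hni2 : ¬ ∃ w : ℤ, (k : ℝ) * ((b : ℝ) - (r : ℝ) / s) = w * (a + b) := by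
    rintro ⟨w, hw⟩
    apply hni
    refine ⟨w, ?_⟩
    rw [div_eq_iff (by positivity)]
    have : (k : ℝ) * (b * s - r) = s * (k * (b - (r : ℝ) / s)) := by
      field_simp
    rw [this, hw]; ring
  generalize (r : ℝ) / s = f at *
  have hn0 : (0 : ℝ) ≤ n := by positivity
  have hz0 : (0 : ℝ) ≤ z := by
    by_contra hc; push Not at hc; nlinarith
  have hzn : (z : ℝ) ≤ n := by
    by_contra hc; push Not at hc; nlinarith
  obtain ⟨p, rfl⟩ := Int.eq_ofNat_of_zero_le (by exact_mod_cast hz0 : 0 ≤ z)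
  have hpn : p ≤ n := by exact_mod_cast hzn
  have hsumA : ∀ A : Finset (Fin n),
      ∑ i ∈ A, ((if i.val < p then ((a : ℝ) + b) else 0) + (f - b)) =
      (A.filter (fun i => i.val < p)).card * ((a : ℝ) + b) + A.card * (f - b) := by
    intro A
    rw [Finset.sum_add_distrib, ← Finset.sum_filter]
    simp only [Finset.sum_const, nsmul_eq_mul]
  refine ⟨fun i => (if i.val < p then ((a : ℝ) + b) else 0) + (f - b), ⟨?_, ?_⟩, ?_⟩
  · rw [hsumA]
    have : (Finset.univ.filter (fun i : Fin n => i.val < p)).card = p := by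
      rw [Fin.card_filter_val_lt]; omega
    rw [this]
    simp only [Finset.card_univ, Fintype.card_fin]
    push_cast at hz2
    linarith
  · intro A hA
    rw [hsumA, hA]
    obtain ⟨c, hc⟩ := hkf
    refine ⟨(A.filter (fun i => i.val < p)).card * (a + b) + (c - k * b), ?_, ?_⟩
    · intro h0
      apply hni2
      refine ⟨(A.filter (fun i => i.val < p)).card, ?_⟩
      have h1 : (((A.filter (fun i => i.val < p)).card * (a + b) + (c - k * b) : ℤ) : ℝ) = 0 := by
        rw [h0]; simp
      push_cast at h1 ⊢
      linarith
    · push_cast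
      rw [← hc]; ring
  · intro A hA
    rw [abs_le]
    constructor
    · have := Finset.card_nsmul_le_sum A
        (fun i => (if i.val < p then ((a : ℝ) + b) else 0) + (f - b)) (f - b) (by
          intro i _; split_ifs <;> linarith)
      rw [hA, nsmul_eq_mul] at this
      have h2 := le_max_right ((k : ℝ) * (a + f)) (k * (b - f))
      linarith
    · have := Finset.sum_le_card_nsmul A
        (fun i => (if i.val < p then ((a : ℝ) + b) else 0) + (f - b)) (a + f) (by
          intro i _; split_ifs <;> linarith)
      rw [hA, nsmul_eq_mul] at this
      exact this.trans (le_max_left _ _)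

theorem mJ_eq_of_integrality (n k a b r s : ℕ) (hk : 2 ≤ k) (hn : TF k < (n : ℚ))
    (hM : InM n k a b r s)
    (hint : ∃ z : ℤ, ((b : ℝ) * (s : ℝ) - (r : ℝ)) * (n : ℝ) /
      ((s : ℝ) * ((a : ℝ) + (b : ℝ))) = z) :
    (mJ n k : ℝ) = Nval n k + 1 := by
  obtain ⟨hB, hmax⟩ := hM
  obtain ⟨u, hu, hub⟩ := aux_upper n k a b r s hB hint
  rw [hmax] at hub
  have hkn : k ≤ n := by
    obtain ⟨C, hC, hj, _⟩ := aux_C n k hk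
    have := aux_T n k C hk hC hj hn
    nlinarith [Nat.zero_le (k ^ 2 * C * (C + 1))]
  have hne : Nonempty {A : Finset (Fin n) // A.card = k} := by
    obtain ⟨A, _, hA⟩ := Finset.exists_subset_card_eq
      (s := (Finset.univ : Finset (Fin n))) (n := k) (by simpa using hkn)
    exact ⟨⟨A, hA⟩⟩
  have hle : maxNormJ n k u ≤ Nval n k := ciSup_le (fun A => hub A.1 A.2)
  obtain ⟨A0, hA0⟩ := exists_eq_ciSup_of_finite
    (f := fun A : {A : Finset (Fin n) // A.card = k} => |∑ i ∈ A.1, u i|)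
  obtain ⟨z, _, hz⟩ := hu.2 A0.1 A0.2
  have hmem : 1 + z.natAbs ∈
      {m : ℕ | ∃ u : Fin n → ℝ, KFeasible n k u ∧ (m : ℝ) = 1 + maxNormJ n k u} := by
    refine ⟨u, hu, ?_⟩
    unfold maxNormJ
    rw [← hA0, hz]
    push_cast
    simp [Nat.cast_natAbs]
  have hup : (mJ n k : ℝ) ≤ Nval n k + 1 := by
    have h1 : mJ n k ≤ 1 + z.natAbs := Nat.sInf_le hmem
    have h2 : (mJ n k : ℝ) ≤ ((1 + z.natAbs : ℕ) : ℝ) := by exact_mod_cast h1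
    obtain ⟨v, hv⟩ := hmem
    have h3 : ((1 + z.natAbs : ℕ) : ℝ) = 1 + maxNormJ n k u := by
      unfold maxNormJ
      rw [← hA0, hz]
      push_cast
      simp [Nat.cast_natAbs]
    linarith
  obtain ⟨v, hv, hvm⟩ := Nat.sInf_mem ⟨_, hmem⟩
  have hlow := aux_lower n k hk hn v hv (maxNormJ n k v) (by
    intro A hA
    exact le_ciSup (f := fun A : {A : Finset (Fin n) // A.card = k} => |∑ i ∈ A.1, v i|)
      (Set.finite_range _).bddAbove ⟨A, hA⟩)
  change (mJ n k : ℝ) = _ at hvm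
  linarith
end
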